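/- Under the same hypotheses (bounded strictly positive $C^2$ diffusivity $D$, balanced bistable $f$, initial datum $u_0^\varepsilon$ with an $N$-transition layer structure relative to $v$ and $A\in(0,r\sqrt{2\lambda})$), the solution $u^\varepsilon$ of the Neumann initial–boundary value problem satisfies, for every $m>0$, $\sup_{0\leq t\leq m\exp(A/\varepsilon)}\|u^\varepsilon(\cdot,t)-v\|_{L^1(a,b)}\to 0$ as $\varepsilon\to 0^+$. Moreover, along the way one shows $\sup_{0\leq t\leq m\exp(A/\varepsilon)}\|u^\varepsilon(\cdot,t)-u_0^\varepsilon\|_{L^1}\leq C\sqrt{\varepsilon}$ for small $\varepsilon$. -/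

import Mathlib

open MeasureTheory Set Filter

/-- The pointwise data of a layer profile on `[x, y]`: `F` is a profile measured in the
Modica–Mortola variable, `g` its potential and `p` its flux. -/
structure IsProfile (x y : ℝ) (F g p : ℝ → ℝ) : Prop where
  hasDerivAt : ∀ z ∈ Icc x y, HasDerivAt F (√(2 * g z) * p z) z
  nonneg : ∀ z ∈ Icc x y, 0 ≤ g z
  contPot : ContinuousOn g (Icc x y)
  contFlux : ContinuousOn p (Icc x y)

/-- The energy density of a profile. -/
noncomputable def profileDensity (ε : ℝ) (g p : ℝ → ℝ) (x : ℝ) : ℝ :=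
  ε / 2 * p x ^ 2 + g x / ε

namespace IsProfile

variable {x y x' y' ε : ℝ} {F g p : ℝ → ℝ}

lemma mono (hP : IsProfile x y F g p) (hx : x ≤ x') (hy : y' ≤ y) : IsProfile x' y' F g p :=
  have hs : Icc x' y' ⊆ Icc x y := Icc_subset_Icc hx hy
  ⟨fun z hz => hP.hasDerivAt z (hs hz), fun z hz => hP.nonneg z (hs hz),
    hP.contPot.mono hs, hP.contFlux.mono hs⟩

lemma continuousOn_density (hP : IsProfile x y F g p) :
    ContinuousOn (profileDensity ε g p) (Icc x y) :=
  (continuousOn_const.mul (hP.contFlux.pow 2)).add (hP.contPot.div_const ε)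

lemma continuousOn (hP : IsProfile x y F g p) : ContinuousOn F (Icc x y) :=
  fun z hz => (hP.hasDerivAt z hz).continuousAt.continuousWithinAt

lemma density_nonneg (hP : IsProfile x y F g p) (hε : 0 < ε) {z : ℝ} (hz : z ∈ Icc x y) :
    0 ≤ profileDensity ε g p z := by
  have := hP.nonneg z hz
  unfold profileDensity
  positivity

lemma neg (hP : IsProfile x y F g p) : IsProfile x y (fun z => -F z) g (fun z => -p z) :=
  ⟨fun z hz => (hP.hasDerivAt z hz).fun_neg.congr_deriv (mul_neg _ _).symm, hP.nonneg, hP.contPot, hP.contFlux.neg⟩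

lemma reflect (hP : IsProfile x y F g p) :
    IsProfile (-y) (-x) (fun z => F (-z)) (fun z => g (-z)) (fun z => -p (-z)) := by
  have hs : ∀ z ∈ Icc (-y) (-x), -z ∈ Icc x y := fun z hz => ⟨by linarith [hz.2], by linarith [hz.1]⟩
  refine ⟨fun z hz => ?_, fun z hz => hP.nonneg _ (hs z hz),
    hP.contPot.comp continuousOn_neg hs, (hP.contFlux.comp continuousOn_neg hs).neg⟩
  exact ((hP.hasDerivAt _ (hs z hz)).scomp z (hasDerivAt_neg z)).congr_deriv (by simp)

/-- The scaled Young inequality behind every calibration of the energy. -/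
lemma young {s P e : ℝ} (he : 0 < e) (hs : 0 ≤ s) (θ : ℝ) :
    θ * (√(2 * s) * P) ≤ e / 2 * P ^ 2 + θ ^ 2 * s / e := by
  have h1 : √(2 * s) ^ 2 = 2 * s := Real.sq_sqrt (by positivity)
  have h2 : 0 ≤ (e * P - θ * √(2 * s)) ^ 2 / (2 * e) := by positivity
  have h3 : (e * P - θ * √(2 * s)) ^ 2 / (2 * e)
      = e / 2 * P ^ 2 + θ ^ 2 * s / e - θ * (√(2 * s) * P) := by
    field_simp
    linear_combination θ ^ 2 * h1
  linarith

lemma sub_le_energy (hP : IsProfile x y F g p) (hε : 0 < ε) (hxy : x ≤ y) :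
    F y - F x ≤ ∫ z in x..y, profileDensity ε g p z := by
  refine intervalIntegral.sub_le_integral_of_hasDeriv_right_of_le hxy hP.continuousOn
    (fun z hz => (hP.hasDerivAt z (Ioo_subset_Icc_self hz)).hasDerivWithinAt)
    hP.continuousOn_density.integrableOn_Icc (fun z hz => ?_)
  simpa [profileDensity] using
    young (P := p z) hε (hP.nonneg z (Ioo_subset_Icc_self hz)) 1

lemma abs_sub_le_energy (hP : IsProfile x y F g p) (hε : 0 < ε) (hxy : x ≤ y) :
    |F y - F x| ≤ ∫ z in x..y, profileDensity ε g p z := by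
  rw [abs_le]
  have h1 := hP.sub_le_energy hε hxy
  have h2 := hP.neg.sub_le_energy hε hxy
  simp only [profileDensity, neg_sq] at h1 h2 ⊢
  constructor <;> linarith

lemma abs_sub_le_energy_of_mem (hP : IsProfile x y F g p) (hε : 0 < ε) {s t : ℝ}
    (hxs : x ≤ s) (hst : s ≤ t) (hty : t ≤ y) :
    |F t - F s| ≤ ∫ z in x..y, profileDensity ε g p z := by
  refine ((hP.mono hxs hty).abs_sub_le_energy hε hst).trans ?_
  refine intervalIntegral.integral_mono_interval hxs hst hty ?_ ?_
  · filter_upwards [ae_restrict_mem measurableSet_Ioc] with z hz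
    exact hP.density_nonneg hε (Ioc_subset_Icc_self hz)
  · exact hP.continuousOn_density.intervalIntegrable_of_Icc (hxs.trans (hst.trans hty))

/-- Energy of a half layer by calibration with a hyperbolic tangent weight. -/
lemma tanh_mul_le_energy (hP : IsProfile x y F g p) (hε : 0 < ε) (hxy : x ≤ y) {μ c : ℝ}
    (hg : ∀ z ∈ Icc x y, μ * (F z - c) ≤ g z) :
    Real.tanh (μ * (y - x) / ε) * (F x - c) ≤ ∫ z in x..y, profileDensity ε g p z := by
  set θ : ℝ → ℝ := fun z => Real.tanh (μ * (y - z) / ε) with hθ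
  have hθd : ∀ z, HasDerivAt θ (-(μ / ε) * (1 - θ z ^ 2)) z := by
    intro z
    have hc : Real.cosh (μ * (y - z) / ε) ≠ 0 := (Real.cosh_pos _).ne'
    have h0 : HasDerivAt (fun z => μ * (y - z) / ε) (-(μ / ε)) z := by
      have := (((hasDerivAt_id z).const_sub y).const_mul μ).div_const ε
      exact this.congr_deriv (by ring)
    have h1 := (h0.sinh).div (h0.cosh) hc
    have h2 : θ = fun z => Real.sinh (μ * (y - z) / ε) / Real.cosh (μ * (y - z) / ε) := by
      funext w; simp only [hθ]; rw [Real.tanh_eq_sinh_div_cosh]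
    rw [h2]
    refine h1.congr_deriv ?_
    field_simp
    ring
  have key : -(θ y * (F y - c)) - -(θ x * (F x - c)) ≤ ∫ z in x..y, profileDensity ε g p z := by
    have hd : ∀ z ∈ Icc x y, HasDerivAt (fun z => -(θ z * (F z - c)))
        (-(-(μ / ε) * (1 - θ z ^ 2) * (F z - c) + θ z * (√(2 * g z) * p z))) z := fun z hz =>
      ((hθd z).mul ((hP.hasDerivAt z hz).sub_const c)).neg
    refine intervalIntegral.sub_le_integral_of_hasDeriv_right_of_le hxy
      (fun z hz => (hd z hz).continuousAt.continuousWithinAt)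
      (fun z hz => (hd z (Ioo_subset_Icc_self hz)).hasDerivWithinAt)
      hP.continuousOn_density.integrableOn_Icc (fun z hz => ?_)
    have hz := Ioo_subset_Icc_self hz
    have hy := young (P := p z) hε (hP.nonneg z hz) (-θ z)
    have hθ1 : 0 ≤ 1 - θ z ^ 2 := by
      have := Real.tanh_lt_one (μ * (y - z) / ε)
      have := Real.neg_one_lt_tanh (μ * (y - z) / ε)
      simp only [hθ]; nlinarith
    have h3 : (1 - θ z ^ 2) / ε * (μ * (F z - c)) ≤ (1 - θ z ^ 2) / ε * g z :=
      mul_le_mul_of_nonneg_left (hg z hz) (by positivity)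
    have e1 : (1 - θ z ^ 2) / ε * (μ * (F z - c)) = μ / ε * (1 - θ z ^ 2) * (F z - c) := by ring
    have e2 : (1 - θ z ^ 2) / ε * g z = g z / ε - θ z ^ 2 * g z / ε := by ring
    rw [neg_sq] at hy
    rw [e1, e2] at h3
    unfold profileDensity
    linarith
  have hy0 : θ y = 0 := by simp [hθ]
  rw [hy0] at key
  linarith

/-- Lower energy bound of the half layer starting near the well value `c`. -/
lemma half_layer_right (hP : IsProfile x y F g p) (hε : 0 < ε) (hxy : x ≤ y) {μ c κ : ℝ}
    (hμ : 0 ≤ μ) (hg : ∀ z ∈ Icc x y, |F z - c| ≤ κ → μ * |F z - c| ≤ g z)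
    (hx : |F x - c| ≤ κ / 2) :
    Real.tanh (μ * (y - x) / ε) * |F x - c| ≤ ∫ z in x..y, profileDensity ε g p z := by
  by_cases hs : ∀ z ∈ Icc x y, |F z - c| ≤ κ
  · rcases le_total 0 (F x - c) with h0 | h0
    · rw [abs_of_nonneg h0]
      exact hP.tanh_mul_le_energy hε hxy fun z hz =>
        (mul_le_mul_of_nonneg_left (le_abs_self _) hμ).trans (hg z hz (hs z hz))
    · rw [abs_of_nonpos h0]
      have := hP.neg.tanh_mul_le_energy hε hxy (μ := μ) (c := -c) fun z hz =>
        (mul_le_mul_of_nonneg_left (by linarith [neg_abs_le (F z - c)]) hμ).trans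
          (hg z hz (hs z hz))
      simp only [profileDensity, neg_sq] at this ⊢
      convert this using 2
      ring
  · push Not at hs
    obtain ⟨z, hz, hzκ⟩ := hs
    have h1 := hP.abs_sub_le_energy_of_mem hε le_rfl hz.1 hz.2
    have h2 : |F z - c| ≤ |F z - F x| + |F x - c| := abs_sub_le _ _ _
    have h3 : Real.tanh (μ * (y - x) / ε) * |F x - c| ≤ 1 * |F x - c| :=
      mul_le_mul_of_nonneg_right (Real.tanh_lt_one _).le (abs_nonneg _)
    linarith

lemma half_layer_left (hP : IsProfile x y F g p) (hε : 0 < ε) (hxy : x ≤ y) {μ c κ : ℝ}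
    (hμ : 0 ≤ μ) (hg : ∀ z ∈ Icc x y, |F z - c| ≤ κ → μ * |F z - c| ≤ g z)
    (hy : |F y - c| ≤ κ / 2) :
    Real.tanh (μ * (y - x) / ε) * |F y - c| ≤ ∫ z in x..y, profileDensity ε g p z := by
  have h := hP.reflect.half_layer_right hε (neg_le_neg hxy) (μ := μ) (c := c) (κ := κ) hμ
    (fun z hz => hg (-z) ⟨by linarith [hz.2], by linarith [hz.1]⟩) (by simpa using hy)
  have e : ∫ z in x..y, profileDensity ε g p z
      = ∫ z in -y..-x, profileDensity ε (fun z => g (-z)) (fun z => -p (-z)) z := by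
    rw [← intervalIntegral.integral_comp_neg]
    simp [profileDensity]
  rw [e]
  simpa [neg_add_eq_sub] using h

/-- Lower energy bound of a full layer joining neighbourhoods of two well values. -/
lemma full_layer (hP : IsProfile x y F g p) (hε : 0 < ε) {μ c₁ c₂ κ s t l : ℝ}
    (hμ : 0 ≤ μ) (hl : 0 ≤ l) (hxs : x + l ≤ s) (hst : s ≤ t) (hty : t + l ≤ y)
    (hg₁ : ∀ z ∈ Icc x y, |F z - c₁| ≤ κ → μ * |F z - c₁| ≤ g z)
    (hg₂ : ∀ z ∈ Icc x y, |F z - c₂| ≤ κ → μ * |F z - c₂| ≤ g z)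
    (hs : |F s - c₁| ≤ κ / 2) (ht : |F t - c₂| ≤ κ / 2) :
    Real.tanh (μ * l / ε) * |c₂ - c₁| ≤ ∫ z in x..y, profileDensity ε g p z := by
  have hq := hP.continuousOn_density (ε := ε)
  have hint : ∀ u v, x ≤ u → u ≤ v → v ≤ y →
      IntervalIntegrable (profileDensity ε g p) volume u v := fun u v hu huv hv =>
    (hq.mono (Icc_subset_Icc hu hv)).intervalIntegrable_of_Icc huv
  have i1 := (hP.mono (x' := s - l) (y' := s) (by linarith) (by linarith)).half_layer_left hε
    (by linarith) hμ (fun z hz => hg₁ z ⟨by linarith [hz.1], by linarith [hz.2]⟩) hs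
  have i2 := (hP.mono (x' := s) (y' := t) (by linarith) (by linarith)).abs_sub_le_energy hε hst
  have i3 := (hP.mono (x' := t) (y' := t + l) (by linarith) (by linarith)).half_layer_right hε
    (by linarith) hμ (fun z hz => hg₂ z ⟨by linarith [hz.1], by linarith [hz.2]⟩) ht
  have a1 := intervalIntegral.integral_add_adjacent_intervals
    (hint (s - l) s (by linarith) (by linarith) (by linarith))
    (hint s t (by linarith) hst (by linarith))
  have a2 := intervalIntegral.integral_add_adjacent_intervals
    (hint (s - l) t (by linarith) (by linarith) (by linarith))
    (hint t (t + l) (by linarith) (by linarith) (by linarith))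
  have a3 : ∫ z in (s - l)..(t + l), profileDensity ε g p z
      ≤ ∫ z in x..y, profileDensity ε g p z := by
    refine intervalIntegral.integral_mono_interval (by linarith) (by linarith) (by linarith) ?_
      (hint x y le_rfl (by linarith) le_rfl)
    filter_upwards [ae_restrict_mem measurableSet_Ioc] with z hz
    exact hP.density_nonneg hε (Ioc_subset_Icc_self hz)
  rw [sub_sub_cancel] at i1
  rw [add_sub_cancel_left] at i3
  set θ := Real.tanh (μ * l / ε)
  have hθ1 : θ ≤ 1 := (Real.tanh_lt_one _).le
  have hθ0 : 0 ≤ θ := by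
    change 0 ≤ Real.tanh _
    rw [Real.tanh_eq_sinh_div_cosh]
    exact div_nonneg (Real.sinh_nonneg_iff.2 (by positivity)) (Real.cosh_pos _).le
  have tri : |c₂ - c₁| ≤ |F t - c₂| + |F t - F s| + |F s - c₁| := by
    have : c₂ - c₁ = -(F t - c₂) + (F t - F s) + (F s - c₁) := by ring
    rw [this]
    refine (abs_add_three _ _ _).trans_eq ?_
    rw [abs_neg]
  have h1 := mul_le_mul_of_nonneg_left tri hθ0
  have h2 : θ * |F t - F s| ≤ |F t - F s| := mul_le_of_le_one_left (abs_nonneg _) hθ1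
  linarith

/-- The energies of disjoint subintervals add up to at most the total energy. -/
lemma sum_energy_le (hP : IsProfile x y F g p) (hε : 0 < ε) (hxy : x ≤ y) {ι : Type*} [Fintype ι]
    (l r : ι → ℝ) (hlr : ∀ i, l i ≤ r i) (hl : ∀ i, x ≤ l i) (hr : ∀ i, r i ≤ y)
    (hdisj : Pairwise fun i j => Disjoint (Ioc (l i) (r i)) (Ioc (l j) (r j))) :
    ∑ i, ∫ z in (l i)..(r i), profileDensity ε g p z
      ≤ ∫ z in x..y, profileDensity ε g p z := by
  have hI : IntegrableOn (profileDensity ε g p) (Ioc x y) :=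
    hP.continuousOn_density.integrableOn_Icc.mono_set Ioc_subset_Icc_self
  have hs : ∀ i, Ioc (l i) (r i) ⊆ Ioc x y := fun i => Ioc_subset_Ioc (hl i) (hr i)
  simp_rw [intervalIntegral.integral_of_le hxy, intervalIntegral.integral_of_le (hlr _)]
  rw [← integral_iUnion_fintype (fun i => measurableSet_Ioc) hdisj (fun i => hI.mono_set (hs i))]
  refine setIntegral_mono_set hI ?_ (LE.le.eventuallyLE (iUnion_subset hs))
  filter_upwards [ae_restrict_mem measurableSet_Ioc] with z hz
  exact hP.density_nonneg hε (Ioc_subset_Icc_self hz)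

end IsProfile
lemma disjoint_Ioc_windows {N : ℕ} {h : Fin N → ℝ} {r s : ℝ}
    (hsep : ∀ i j : Fin N, i < j → h i + r < h j - r) (hs : s ≤ r) :
    Pairwise fun i j => Disjoint (Ioc (h i - s) (h i + s)) (Ioc (h j - s) (h j + s)) := by
  intro i j hij
  rw [Set.disjoint_left]
  rintro x ⟨h1, h2⟩ ⟨h3, h4⟩
  rcases lt_or_gt_of_ne hij with hl | hl
  · linarith [hsep i j hl]
  · linarith [hsep j i hl]

/-- A profile `F` on `[a, b]` that follows, up to the error `κ'` and on the scale `ℓ`, a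
step function `V` with values in `{0, γ}` jumping exactly at the `h i`. -/
structure IsLayered (a b r ℓ γ κ' : ℝ) {N : ℕ} (h : Fin N → ℝ) (F V : ℝ → ℝ) : Prop where
  sep : ∀ i j : Fin N, i < j → h i + r < h j - r
  left_le : ∀ i, a ≤ h i - r
  le_right : ∀ i, h i + r ≤ b
  value : ∀ x ∈ Icc a b, V x = 0 ∨ V x = γ
  jump : ∀ i x y, h i - r ≤ x → x < h i → h i < y → y ≤ h i + r → V x ≠ V y
  scale_pos : 0 < ℓ
  scale_le : 8 * ℓ ≤ r
  scale_le_length : 2 * ℓ ≤ b - a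
  good : ∀ x y, a ≤ x → y ≤ b → x + ℓ ≤ y → ∃ z ∈ Icc x y, |F z - V z| ≤ κ'

namespace IsLayered

variable {a b r ℓ γ κ' ε : ℝ} {N : ℕ} {h : Fin N → ℝ} {F V g p : ℝ → ℝ}

/-- On both sides of a jump there are points where the profile is close to the two wells. -/
lemma exists_pair (hL : IsLayered a b r ℓ γ κ' h F V) (i : Fin N) {s : ℝ} (hs : 0 < s)
    (hsr : s + ℓ ≤ r) :
    ∃ x ∈ Icc (h i - (s + ℓ)) (h i - s), ∃ y ∈ Icc (h i + s) (h i + (s + ℓ)),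
      |F x - V x| ≤ κ' ∧ |F y - V y| ≤ κ' ∧ ((V x = 0 ∧ V y = γ) ∨ (V x = γ ∧ V y = 0)) := by
  have h1 := hL.left_le i
  have h2 := hL.le_right i
  have hℓ := hL.scale_pos
  obtain ⟨x, hx, hxF⟩ := hL.good (h i - (s + ℓ)) (h i - s) (by linarith) (by linarith)
    (by linarith)
  obtain ⟨y, hy, hyF⟩ := hL.good (h i + s) (h i + (s + ℓ)) (by linarith) (by linarith)
    (by linarith)
  refine ⟨x, hx, y, hy, hxF, hyF, ?_⟩
  have hj := hL.jump i x y (by linarith [hx.1]) (by linarith [hx.2]) (by linarith [hy.1])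
    (by linarith [hy.2])
  rcases hL.value x ⟨by linarith [hx.1], by linarith [hx.2]⟩ with hx0 | hx0 <;>
  rcases hL.value y ⟨by linarith [hy.1], by linarith [hy.2]⟩ with hy0 | hy0
  · exact absurd (hx0.trans hy0.symm) hj
  · exact Or.inl ⟨hx0, hy0⟩
  · exact Or.inr ⟨hx0, hy0⟩
  · exact absurd (hx0.trans hy0.symm) hj

/-- Exponentially sharp lower bound for the energy of a layered profile. -/
lemma energy_ge (hL : IsLayered a b r ℓ γ κ' h F V) (hP : IsProfile a b F g p) (hε : 0 < ε)
    (hab : a ≤ b) {μ κ : ℝ} (hμ : 0 ≤ μ) (hγ : 0 ≤ γ) (hκ : κ' ≤ κ / 2)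
    (hw : ∀ c, c = 0 ∨ c = γ → ∀ x ∈ Icc a b, |F x - c| ≤ κ → μ * |F x - c| ≤ g x) :
    N * (Real.tanh (μ * (3 / 4 * r) / ε) * γ) ≤ ∫ z in a..b, profileDensity ε g p z := by
  have hℓ := hL.scale_pos
  have hℓr := hL.scale_le
  refine le_trans ?_ (hP.sum_energy_le hε hab (fun i => h i - r) (fun i => h i + r)
    (fun i => by linarith) hL.left_le hL.le_right (disjoint_Ioc_windows hL.sep le_rfl))
  have key : ∀ i, Real.tanh (μ * (3 / 4 * r) / ε) * γ
      ≤ ∫ z in (h i - r)..(h i + r), profileDensity ε g p z := by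
    intro i
    obtain ⟨x, hx, y, hy, hxF, hyF, hV⟩ := hL.exists_pair i hℓ (by linarith)
    have hPi := hP.mono (hL.left_le i) (hL.le_right i)
    have hsub : Icc (h i - r) (h i + r) ⊆ Icc a b := Icc_subset_Icc (hL.left_le i) (hL.le_right i)
    have hwx : V x = 0 ∨ V x = γ := by tauto
    have hwy : V y = 0 ∨ V y = γ := by tauto
    have := hPi.full_layer hε (μ := μ) (l := 3 / 4 * r) (c₁ := V x) (c₂ := V y) (κ := κ)
      (s := x) (t := y) hμ (by linarith) (by linarith [hx.1]) (by linarith [hx.2, hy.1])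
      (by linarith [hy.2]) (fun z hz => hw _ hwx z (hsub hz)) (fun z hz => hw _ hwy z (hsub hz))
      (hxF.trans hκ) (hyF.trans hκ)
    have e : |V y - V x| = γ := by
      rcases hV with ⟨h1, h2⟩ | ⟨h1, h2⟩ <;> rw [h1, h2] <;> simp [abs_of_nonneg hγ]
    rwa [e] at this
  calc (N : ℝ) * (Real.tanh (μ * (3 / 4 * r) / ε) * γ)
      = ∑ _i : Fin N, Real.tanh (μ * (3 / 4 * r) / ε) * γ := by simp
    _ ≤ _ := Finset.sum_le_sum fun i _ => key i

/-- Rough lower bound for the energy around one jump. -/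
lemma window_energy_ge (hL : IsLayered a b r ℓ γ κ' h F V) (hP : IsProfile a b F g p)
    (hε : 0 < ε) (i : Fin N) {s : ℝ} (hs : 0 < s) (hsr : s + ℓ ≤ r) :
    γ - 2 * κ' ≤ ∫ z in (h i - (s + ℓ))..(h i + (s + ℓ)), profileDensity ε g p z := by
  obtain ⟨x, hx, y, hy, hxF, hyF, hV⟩ := hL.exists_pair i hs hsr
  refine le_trans ?_ ((hP.mono (x' := h i - (s + ℓ)) (y' := h i + (s + ℓ))
    (by linarith [hL.left_le i]) (by linarith [hL.le_right i])).abs_sub_le_energy_of_mem hε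
    hx.1 (by linarith [hx.2, hy.1]) hy.2)
  rw [abs_le] at hxF hyF
  rcases hV with ⟨h1, h2⟩ | ⟨h1, h2⟩ <;> rw [h1] at hxF <;> rw [h2] at hyF
  · linarith [le_abs_self (F y - F x)]
  · linarith [neg_abs_le (F y - F x)]

/-- A profile leaving the range between the wells pays a definite amount of extra energy. -/
lemma energy_ge_of_exit (hL : IsLayered a b r ℓ γ κ' h F V) (hP : IsProfile a b F g p)
    (hε : 0 < ε) (hγ : 0 ≤ γ) (hκ : 0 ≤ κ') {c : ℝ} (hc : (2 * N + 1) * κ' ≤ c / 2)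
    {x : ℝ} (hx : x ∈ Icc a b) (hexit : F x ≤ -c ∨ γ + c ≤ F x) :
    N * γ + c / 2 ≤ ∫ z in a..b, profileDensity ε g p z := by
  have hℓ := hL.scale_pos
  have hℓr := hL.scale_le
  have hN0 : (0 : ℝ) ≤ N * κ' := by positivity
  by_cases hnear : ∃ i, |x - h i| ≤ 3 * ℓ
  · obtain ⟨i, hi⟩ := hnear
    rw [abs_le] at hi
    refine le_trans ?_ (hP.sum_energy_le hε (hx.1.trans hx.2) (fun i => h i - (3 * ℓ + ℓ))
      (fun i => h i + (3 * ℓ + ℓ)) (fun i => by linarith) (fun i => by linarith [hL.left_le i])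
      (fun i => by linarith [hL.le_right i]) (disjoint_Ioc_windows hL.sep (by linarith)))
    have key : ∀ j, (γ - 2 * κ') + (if j = i then 2 * c else 0)
        ≤ ∫ z in (h j - (3 * ℓ + ℓ))..(h j + (3 * ℓ + ℓ)), profileDensity ε g p z := by
      intro j
      split_ifs with hji
      · subst hji
        obtain ⟨y, hy, z, hz, hyF, hzF, hV⟩ := hL.exists_pair j (s := 3 * ℓ) (by linarith)
          (by linarith)
        have hPj := hP.mono (x' := h j - (3 * ℓ + ℓ)) (y' := h j + (3 * ℓ + ℓ))
          (by linarith [hL.left_le j]) (by linarith [hL.le_right j])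
        have b1 := (hPj.mono (y' := x) le_rfl (by linarith)).abs_sub_le_energy_of_mem hε
          hy.1 (by linarith [hy.2]) le_rfl
        have b2 := (hPj.mono (x' := x) (by linarith) le_rfl).abs_sub_le_energy_of_mem hε
          le_rfl (by linarith [hz.1]) hz.2
        have b3 := intervalIntegral.integral_add_adjacent_intervals
          ((hPj.mono (y' := x) le_rfl (by linarith)).continuousOn_density
            (ε := ε)|>.intervalIntegrable_of_Icc (μ := volume) (by linarith))
          ((hPj.mono (x' := x) (by linarith) le_rfl).continuousOn_density
            (ε := ε)|>.intervalIntegrable_of_Icc (by linarith))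
        rw [abs_le] at hyF hzF
        have c1 := le_abs_self (F x - F y)
        have c2 := neg_abs_le (F x - F y)
        have c3 := le_abs_self (F z - F x)
        have c4 := neg_abs_le (F z - F x)
        rcases hV with ⟨h1, h2⟩ | ⟨h1, h2⟩ <;> rw [h1] at hyF <;> rw [h2] at hzF <;>
          rcases hexit with he | he <;> linarith
      · rw [add_zero]
        exact hL.window_energy_ge hP hε j (by linarith) (by linarith)
    refine le_trans ?_ (Finset.sum_le_sum fun j _ => key j)
    rw [Finset.sum_add_distrib]
    simp only [Finset.sum_const, Finset.card_univ, Fintype.card_fin, nsmul_eq_mul,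
      Finset.sum_ite_eq', Finset.mem_univ, if_true]
    linarith
  · push Not at hnear
    obtain ⟨l, u, hl, hlu, hu, hlx, hxu, hux, hxl⟩ : ∃ l u, a ≤ l ∧ l + ℓ ≤ u ∧ u ≤ b ∧ l ≤ x ∧
        x ≤ u ∧ u ≤ x + ℓ ∧ x - ℓ ≤ l := by
      by_cases hxb : x + ℓ ≤ b
      · exact ⟨x, x + ℓ, hx.1, le_rfl, hxb, le_rfl, by linarith, le_rfl, by linarith⟩
      · exact ⟨x - ℓ, x, by linarith [hL.scale_le_length], by linarith, hx.2, by linarith, le_rfl,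
          by linarith, le_rfl⟩
    set L : Option (Fin N) → ℝ := fun o => o.elim l fun i => h i - (ℓ + ℓ) with hLdef
    set U : Option (Fin N) → ℝ := fun o => o.elim u fun i => h i + (ℓ + ℓ) with hUdef
    have hsum := hP.sum_energy_le hε (hx.1.trans hx.2) L U
      (by rintro (_ | i) <;> simp only [hLdef, hUdef, Option.elim] <;> linarith)
      (by rintro (_ | i) <;> simp only [hLdef, Option.elim]
          · exact hl
          · linarith [hL.left_le i])
      (by rintro (_ | i) <;> simp only [hUdef, Option.elim]
          · exact hu
          · linarith [hL.le_right i])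
      (by
        have hd : ∀ i, Disjoint (Ioc l u) (Ioc (h i - (ℓ + ℓ)) (h i + (ℓ + ℓ))) := by
          intro i
          rw [Set.disjoint_left]
          rintro z ⟨z1, z2⟩ ⟨z3, z4⟩
          rcases lt_abs.1 (hnear i) with h1 | h1 <;> linarith
        have hw := disjoint_Ioc_windows (s := ℓ + ℓ) hL.sep (by linarith)
        rintro (_ | i) (_ | j) hij
        · exact absurd rfl hij
        · exact hd j
        · exact (hd i).symm
        · exact hw fun e => hij (congrArg some e))
    rw [Fintype.sum_option] at hsum
    refine le_trans ?_ hsum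
    have hw : ∑ _i : Fin N, (γ - 2 * κ') ≤ ∑ i : Fin N, ∫ z in (L (some i))..(U (some i)),
        profileDensity ε g p z :=
      Finset.sum_le_sum fun i _ => hL.window_energy_ge hP hε i hℓ (by linarith)
    rw [Finset.sum_const, Finset.card_univ, Fintype.card_fin, nsmul_eq_mul] at hw
    have hgap : c - κ' ≤ ∫ z in (L none)..(U none), profileDensity ε g p z := by
      obtain ⟨z, hz, hzF⟩ := hL.good l u hl hu hlu
      have hPl := hP.mono hl hu
      have hV := hL.value z ⟨hl.trans hz.1, hz.2.trans hu⟩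
      have hd : c - κ' ≤ |F x - F z| := by
        have c1 := le_abs_self (F x - F z)
        have c2 := neg_abs_le (F x - F z)
        rw [abs_le] at hzF
        rcases hV with hV | hV <;> rw [hV] at hzF <;> rcases hexit with he | he <;> linarith
      refine hd.trans ?_
      rcases le_total x z with hxz | hxz
      · rw [abs_sub_comm]
        exact hPl.abs_sub_le_energy_of_mem hε hlx hxz hz.2
      · exact hPl.abs_sub_le_energy_of_mem hε hz.1 hxz hxu
    linarith

end IsLayered
lemma hasDerivAt_integral_of_continuousOn {I : Set ℝ} (hI : IsOpen I) (hc : I.OrdConnected)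
    {φ : ℝ → ℝ} (hφ : ContinuousOn φ I) {x s : ℝ} (hx : x ∈ I) (hs : s ∈ I) :
    HasDerivAt (fun t => ∫ z in x..t, φ z) (φ s) s := by
  refine intervalIntegral.integral_hasDerivAt_right ?_ ?_ (hφ.continuousAt (hI.mem_nhds hs))
  · exact (hφ.mono (hc.uIcc_subset hx hs)).intervalIntegrable
  · exact hφ.stronglyMeasurableAtFilter hI s hs

/-- A function whose derivative has the sign of `s - w` is minimal at `w`. -/
lemma le_of_deriv_mul_sub_nonneg {w ρ : ℝ} {φ φ' : ℝ → ℝ}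
    (hφ : ∀ s ∈ Metric.ball w ρ, HasDerivAt φ (φ' s) s)
    (hsign : ∀ s ∈ Metric.ball w ρ, 0 ≤ φ' s * (s - w)) {s : ℝ} (hs : s ∈ Metric.ball w ρ) :
    φ w ≤ φ s := by
  have hw : w ∈ Metric.ball w ρ := Metric.mem_ball_self (Metric.pos_of_mem_ball hs)
  have hsub : ∀ {x y : ℝ}, x ∈ Metric.ball w ρ → y ∈ Metric.ball w ρ →
      Icc x y ⊆ Metric.ball w ρ := fun hx hy =>
    (convex_ball w ρ).ordConnected.out hx hy
  rcases lt_trichotomy s w with h | rfl | h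
  · have hb := hsub hs hw
    obtain ⟨c, hc, hc'⟩ := exists_hasDerivAt_eq_slope φ φ' h
      (fun z hz => (hφ z (hb hz)).continuousAt.continuousWithinAt)
      (fun z hz => hφ z (hb (Ioo_subset_Icc_self hz)))
    have h1 := hsign c (hb (Ioo_subset_Icc_self hc))
    have h2 : φ' c ≤ 0 := by nlinarith [hc.2]
    rw [hc', div_le_iff₀ (by linarith)] at h2
    linarith
  · exact le_rfl
  · have hb := hsub hw hs
    obtain ⟨c, hc, hc'⟩ := exists_hasDerivAt_eq_slope φ φ' h
      (fun z hz => (hφ z (hb hz)).continuousAt.continuousWithinAt)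
      (fun z hz => hφ z (hb (Ioo_subset_Icc_self hz)))
    have h1 := hsign c (hb (Ioo_subset_Icc_self hc))
    have h2 : 0 ≤ φ' c := by nlinarith [hc.1]
    rw [hc', le_div_iff₀ (by linarith)] at h2
    linarith

/-- A balanced bistable reaction term `f` with diffusivity `D` and potential `G` on the open
interval `I`. -/
structure IsBistable (I : Set ℝ) (D f G : ℝ → ℝ) (α β : ℝ) : Prop where
  isOpen : IsOpen I
  ordConnected : I.OrdConnected
  lt : α < β
  subset : Icc α β ⊆ I
  contD : ContinuousOn D I
  posD : ∀ s ∈ I, 0 < D s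
  smooth : ContDiffOn ℝ 1 f I
  zero_left : f α = 0
  zero_right : f β = 0
  balanced : ∫ s in α..β, f s * D s = 0
  potential : ∀ s, G s = ∫ z in α..s, f z * D z
  pos : ∀ s ∈ I, s ≠ α → s ≠ β → 0 < G s

/-- The Modica–Mortola primitive. -/
noncomputable def modicaPrimitive (D G : ℝ → ℝ) (α s : ℝ) : ℝ := ∫ z in α..s, √(2 * G z) * D z

namespace IsBistable

variable {I : Set ℝ} {D f G : ℝ → ℝ} {α β : ℝ}

lemma left_mem (hB : IsBistable I D f G α β) : α ∈ I := hB.subset (left_mem_Icc.2 hB.lt.le)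

lemma right_mem (hB : IsBistable I D f G α β) : β ∈ I := hB.subset (right_mem_Icc.2 hB.lt.le)

lemma G_left (hB : IsBistable I D f G α β) : G α = 0 := by rw [hB.potential]; simp

lemma G_right (hB : IsBistable I D f G α β) : G β = 0 := by rw [hB.potential, hB.balanced]

lemma G_nonneg (hB : IsBistable I D f G α β) {s : ℝ} (hs : s ∈ I) : 0 ≤ G s := by
  by_cases h1 : s = α
  · rw [h1, hB.G_left]
  by_cases h2 : s = β
  · rw [h2, hB.G_right]
  exact (hB.pos s hs h1 h2).le

lemma hasDerivAt_G (hB : IsBistable I D f G α β) {s : ℝ} (hs : s ∈ I) :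
    HasDerivAt G (f s * D s) s := by
  rw [show G = fun s => ∫ z in α..s, f z * D z from funext hB.potential]
  exact hasDerivAt_integral_of_continuousOn hB.isOpen hB.ordConnected
    (hB.smooth.continuousOn.mul hB.contD) hB.left_mem hs

lemma contG (hB : IsBistable I D f G α β) : ContinuousOn G I :=
  fun _ hs => (hB.hasDerivAt_G hs).continuousAt.continuousWithinAt

lemma continuousOn_speed (hB : IsBistable I D f G α β) :
    ContinuousOn (fun z => √(2 * G z) * D z) I :=
  (Real.continuous_sqrt.comp_continuousOn (continuousOn_const.mul hB.contG)).mul hB.contD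

lemma hasDerivAt_modica (hB : IsBistable I D f G α β) {s : ℝ} (hs : s ∈ I) :
    HasDerivAt (modicaPrimitive D G α) (√(2 * G s) * D s) s :=
  hasDerivAt_integral_of_continuousOn hB.isOpen hB.ordConnected hB.continuousOn_speed
    hB.left_mem hs

lemma modica_left : modicaPrimitive D G α α = 0 := by simp [modicaPrimitive]

lemma strictMonoOn_modica (hB : IsBistable I D f G α β) :
    StrictMonoOn (modicaPrimitive D G α) I := by
  intro x hx y hy hxy
  have hs : Icc x y ⊆ I := hB.ordConnected.out hx hy
  have hne : ∃ c ∈ Ioo x y, c ≠ α ∧ c ≠ β := by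
    obtain ⟨c, hc, hc'⟩ := (Ioo_infinite hxy).exists_notMem_finite (toFinite {α, β})
    exact ⟨c, hc, by simpa [not_or] using hc'⟩
  obtain ⟨c, hc, h1, h2⟩ := hne
  have hint : ∀ {u v}, u ∈ I → v ∈ I →
      IntervalIntegrable (fun z => √(2 * G z) * D z) volume u v := fun hu hv =>
    (hB.continuousOn_speed.mono (hB.ordConnected.uIcc_subset hu hv)).intervalIntegrable
  have hpos : 0 < ∫ z in x..y, √(2 * G z) * D z := by
    refine intervalIntegral.integral_pos hxy (hB.continuousOn_speed.mono hs) (fun z hz => ?_)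
      ⟨c, Ioo_subset_Icc_self hc, ?_⟩
    · have := hB.posD z (hs (Ioc_subset_Icc_self hz))
      positivity
    · have hcI := hs (Ioo_subset_Icc_self hc)
      have := hB.pos c hcI h1 h2
      have := hB.posD c hcI
      positivity
  have := intervalIntegral.integral_add_adjacent_intervals (hint hB.left_mem hx) (hint hx hy)
  simp only [modicaPrimitive]
  linarith

/-- Quadratic nondegeneracy of the potential at a well, in the Modica–Mortola variable. -/
lemma exists_ball_well (hB : IsBistable I D f G α β) {w μ : ℝ} (hw : w ∈ I) (hfw : f w = 0)
    (hGw : G w = 0) (hμ : 0 ≤ μ) (hμw : μ ^ 2 * D w < deriv f w) :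
    ∃ ρ > 0, Metric.ball w ρ ⊆ I ∧ ∀ s ∈ Metric.ball w ρ,
      μ * |modicaPrimitive D G α s - modicaPrimitive D G α w| ≤ G s := by
  have hdf : ContinuousOn (deriv f) I := hB.smooth.continuousOn_deriv_of_isOpen hB.isOpen le_rfl
  have hIw := hB.isOpen.mem_nhds hw
  have hev : ∀ᶠ s in nhds w, s ∈ I ∧ μ ^ 2 * D s < deriv f s :=
    Filter.Eventually.and hIw
      ((continuousAt_const.mul (hB.contD.continuousAt hIw)).eventually_lt
        (hdf.continuousAt hIw) hμw)
  obtain ⟨ρ, hρ, hball⟩ := Metric.eventually_nhds_iff_ball.1 hev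
  have hwρ : w ∈ Metric.ball w ρ := Metric.mem_ball_self hρ
  have hdiff : ∀ s ∈ Metric.ball w ρ, HasDerivAt f (deriv f s) s := fun s hs =>
    ((hB.smooth.differentiableOn one_ne_zero).differentiableAt
      (hB.isOpen.mem_nhds (hball s hs).1)).hasDerivAt
  have hmono : MonotoneOn f (Metric.ball w ρ) := by
    refine monotoneOn_of_deriv_nonneg (convex_ball w ρ)
      (fun s hs => (hdiff s hs).continuousAt.continuousWithinAt)
      (fun s hs => (hdiff s (interior_subset hs)).differentiableAt.differentiableWithinAt)
      (fun s hs => ?_)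
    have h1 := hball s (interior_subset hs)
    have := hB.posD s h1.1
    have : 0 ≤ μ ^ 2 * D s := by positivity
    linarith [h1.2]
  have hsign : ∀ s ∈ Metric.ball w ρ, 0 ≤ f s * (s - w) := by
    intro s hs
    rcases le_total s w with h | h
    · have := hmono hs hwρ h
      rw [hfw] at this
      exact mul_nonneg_of_nonpos_of_nonpos this (by linarith)
    · have := hmono hwρ hs h
      rw [hfw] at this
      exact mul_nonneg this (by linarith)
  have hsq : ∀ s ∈ Metric.ball w ρ, (μ * √(2 * G s)) ^ 2 ≤ f s ^ 2 := by
    intro s hs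
    have h := le_of_deriv_mul_sub_nonneg (φ := fun s => f s ^ 2 - 2 * μ ^ 2 * G s)
      (φ' := fun s => 2 * f s * (deriv f s - μ ^ 2 * D s))
      (fun t ht => ((((hdiff t ht).fun_pow 2).sub
        ((hB.hasDerivAt_G (hball t ht).1).const_mul (2 * μ ^ 2)))).congr_deriv
          (by push_cast; ring))
      (fun t ht => by
        have h1 := mul_nonneg (hsign t ht) (sub_nonneg.2 (hball t ht).2.le)
        nlinarith) hs
    simp only [hfw, hGw] at h
    rw [mul_pow, Real.sq_sqrt (by have := hB.G_nonneg (hball s hs).1; positivity)]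
    linarith
  refine ⟨ρ, hρ, fun s hs => (hball s hs).1, fun s hs => ?_⟩
  have habs : ∀ σ : ℝ, |σ| = 1 →
      σ * μ * (modicaPrimitive D G α s - modicaPrimitive D G α w) ≤ G s := by
    intro σ hσ
    have h := le_of_deriv_mul_sub_nonneg
      (φ := fun s => G s - σ * μ * (modicaPrimitive D G α s - modicaPrimitive D G α w))
      (φ' := fun s => (f s - σ * (μ * √(2 * G s))) * D s)
      (fun t ht => ((hB.hasDerivAt_G (hball t ht).1).sub
        (((hB.hasDerivAt_modica (hball t ht).1).sub_const _).const_mul (σ * μ))).congr_deriv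
          (by ring))
      (fun t ht => by
        have hD := hB.posD t (hball t ht).1
        have h1 : |σ * (μ * √(2 * G t))| ≤ |f t| := by
          rw [abs_mul, hσ, one_mul]
          exact sq_le_sq.1 (hsq t ht)
        have h2 : 0 ≤ (f t - σ * (μ * √(2 * G t))) * (t - w) := by
          have h3 : σ * (μ * √(2 * G t)) * (t - w) ≤ |f t| * |t - w| :=
            (le_abs_self _).trans (by rw [abs_mul]; gcongr)
          rw [← abs_mul, abs_of_nonneg (hsign t ht)] at h3
          linarith
        nlinarith) hs
    simp only [hGw, sub_self, mul_zero] at h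
    linarith
  have h1 := habs 1 (by simp)
  have h2 := habs (-1) (by simp)
  rw [← abs_of_nonneg hμ, ← abs_mul, abs_le]
  constructor <;> linarith

lemma exists_well_threshold (hB : IsBistable I D f G α β) {w μ : ℝ} (hw : w ∈ I) (hfw : f w = 0)
    (hGw : G w = 0) (hμ : 0 ≤ μ) (hμw : μ ^ 2 * D w < deriv f w) :
    ∃ κ > 0, ∀ s ∈ I, |modicaPrimitive D G α s - modicaPrimitive D G α w| ≤ κ →
      μ * |modicaPrimitive D G α s - modicaPrimitive D G α w| ≤ G s := by
  obtain ⟨ρ, hρ, hI, hball⟩ := hB.exists_ball_well hw hfw hGw hμ hμw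
  set Ψ := modicaPrimitive D G α
  have hr : w + ρ / 2 ∈ I := hI (by rw [Metric.mem_ball, Real.dist_eq, abs_lt]; constructor <;> linarith)
  have hl : w - ρ / 2 ∈ I := hI (by rw [Metric.mem_ball, Real.dist_eq, abs_lt]; constructor <;> linarith)
  have h1 := hB.strictMonoOn_modica hw hr (by linarith)
  have h2 := hB.strictMonoOn_modica hl hw (by linarith)
  refine ⟨min (Ψ (w + ρ / 2) - Ψ w) (Ψ w - Ψ (w - ρ / 2)), lt_min (sub_pos.2 h1) (sub_pos.2 h2),
    fun s hs hsκ => hball s ?_⟩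
  have h3 := abs_le.1 (hsκ.trans (min_le_left _ _))
  have h4 := abs_le.1 (hsκ.trans (min_le_right _ _))
  have h5 := (hB.strictMonoOn_modica.le_iff_le hs hr).1 (show Ψ s ≤ Ψ (w + ρ / 2) by linarith)
  have h6 := (hB.strictMonoOn_modica.le_iff_le hl hs).1 (show Ψ (w - ρ / 2) ≤ Ψ s by linarith)
  rw [Metric.mem_ball, Real.dist_eq, abs_lt]
  constructor <;> linarith

end IsBistable
/-- A function constant on the components of `[a, b]` minus finitely many points and bounded
there is integrable. -/
lemma intervalIntegrable_of_const_off_finite {a b : ℝ} (hab : a ≤ b) {ι : Type*} [Finite ι]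
    {h : ι → ℝ} {v : ℝ → ℝ} {C : ℝ} (hC : ∀ x ∈ Icc a b, |v x| ≤ C)
    (hconst : ∀ x ∈ Icc a b, ∀ y ∈ Icc a b, x ≤ y → (∀ i, ¬(x ≤ h i ∧ h i ≤ y)) → v x = v y) :
    IntervalIntegrable v volume a b := by
  have hfin : (range h).Finite := finite_range h
  set S : Set ℝ := Ioo a b \ range h with hS
  have hSo : IsOpen S := isOpen_Ioo.sdiff hfin.isClosed
  have hcont : ContinuousOn v S := by
    intro x hx
    refine ContinuousAt.continuousWithinAt ?_
    obtain ⟨ρ, hρ, hball⟩ := Metric.isOpen_iff.1 hSo x hx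
    refine (continuousAt_const (y := v x)).congr ?_
    filter_upwards [Metric.ball_mem_nhds x hρ] with y hy
    have hord := (convex_ball x ρ).ordConnected
    have hx' := Metric.mem_ball_self (x := x) hρ
    have hIcc : ∀ z ∈ S, z ∈ Icc a b := fun z hz => Ioo_subset_Icc_self hz.1
    rcases le_total x y with hxy | hxy
    · exact hconst x (hIcc x hx) y (hIcc y (hball hy)) hxy fun i hi =>
        (hball (hord.out hx' hy hi)).2 (mem_range_self i)
    · exact (hconst y (hIcc y (hball hy)) x (hIcc x hx) hxy fun i hi =>
        (hball (hord.out hy hx' hi)).2 (mem_range_self i)).symm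
  rw [intervalIntegrable_iff_integrableOn_Ioc_of_le hab]
  have hae : S =ᵐ[volume] Ioc a b := by
    have h1 : Ioo a b \ range h =ᵐ[volume] Ioo a b :=
      sdiff_null_ae_eq_self (hfin.measure_zero volume)
    exact h1.trans Ioo_ae_eq_Ioc
  have hmeas : AEStronglyMeasurable v (volume.restrict (Ioc a b)) := by
    rw [← Measure.restrict_congr_set hae]
    exact hcont.aestronglyMeasurable hSo.measurableSet
  refine IntegrableOn.of_bound (by simp) hmeas C ?_
  filter_upwards [ae_restrict_mem measurableSet_Ioc] with x hx
  exact hC x (Ioc_subset_Icc_self hx)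

lemma one_sub_two_mul_exp_le_tanh (y : ℝ) : 1 - 2 * Real.exp (-(2 * y)) ≤ Real.tanh y := by
  have h1 := Real.exp_pos y
  have h2 := Real.exp_pos (-y)
  have h3 : Real.exp (-(2 * y)) = Real.exp (-y) ^ 2 := by rw [← Real.exp_nat_mul]; ring_nf
  have h4 : Real.exp y * Real.exp (-y) = 1 := by rw [← Real.exp_add]; simp
  rw [Real.tanh_eq_sinh_div_cosh, Real.sinh_eq, Real.cosh_eq, le_div_iff₀ (by positivity), h3]
  nlinarith [pow_pos h2 3]

lemma jump_of_const_off {a b r : ℝ} (hr : 0 < r) {N : ℕ} {h : Fin N → ℝ}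
    (hsep : ∀ i j : Fin N, i < j → h i + r < h j - r)
    (hha : ∀ i, a ≤ h i - r) (hhb : ∀ i, h i + r ≤ b) {v : ℝ → ℝ}
    (hconst : ∀ x ∈ Icc a b, ∀ y ∈ Icc a b, x ≤ y → (∀ i, ¬(x ≤ h i ∧ h i ≤ y)) → v x = v y)
    (hjump : ∀ i, v (h i - r) ≠ v (h i + r)) (i : Fin N) {x y : ℝ} (hx : h i - r ≤ x)
    (hxi : x < h i) (hiy : h i < y) (hy : y ≤ h i + r) : v x ≠ v y := by
  have ha := hha i
  have hb := hhb i
  have e1 : v (h i - r) = v x := by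
    refine hconst _ ⟨ha, by linarith⟩ _ ⟨by linarith, by linarith⟩ hx fun j hj => ?_
    rcases lt_trichotomy i j with hij | rfl | hij
    · linarith [hsep i j hij]
    · linarith
    · linarith [hsep j i hij]
  have e2 : v y = v (h i + r) := by
    refine hconst _ ⟨by linarith, by linarith⟩ _ ⟨by linarith, hb⟩ hy fun j hj => ?_
    rcases lt_trichotomy i j with hij | rfl | hij
    · linarith [hsep i j hij]
    · linarith
    · linarith [hsep j i hij]
  rw [← e1, e2]
  exact hjump i

/-- Around every interval of length `ℓ`, a function `L¹`-close to `v` is somewhere pointwise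
close to `v`. -/
lemma exists_abs_sub_lt {a b ℓ ρ : ℝ} (hℓ : 0 < ℓ) (hρ : 0 < ρ) {U v : ℝ → ℝ}
    (hint : IntervalIntegrable (fun x => |U x - v x|) volume a b)
    (hδ : ∫ x in a..b, |U x - v x| < ℓ * ρ) {x y : ℝ} (hx : a ≤ x) (hy : y ≤ b)
    (hxy : x + ℓ ≤ y) : ∃ z ∈ Icc x y, |U z - v z| < ρ := by
  by_contra! hcon
  have h1 : ∫ _z in x..y, ρ ≤ ∫ z in x..y, |U z - v z| := by
    refine intervalIntegral.integral_mono_on (by linarith) intervalIntegrable_const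
      (hint.mono_set ?_) hcon
    rw [uIcc_of_le (by linarith), uIcc_of_le (by linarith)]
    exact Icc_subset_Icc hx hy
  have h2 : ∫ z in x..y, |U z - v z| ≤ ∫ z in a..b, |U z - v z| :=
    intervalIntegral.integral_mono_interval hx (by linarith) hy
      (Eventually.of_forall fun z => abs_nonneg _) hint
  rw [intervalIntegral.integral_const, smul_eq_mul] at h1
  nlinarith

namespace IsBistable

variable {I : Set ℝ} {D f G : ℝ → ℝ} {α β : ℝ}

lemma isProfile (hB : IsBistable I D f G α β) {a b : ℝ} {U U' : ℝ → ℝ}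
    (hU : ∀ x ∈ Icc a b, HasDerivAt U (U' x) x) (hUd : ContinuousOn U' (Icc a b))
    (hI : MapsTo U (Icc a b) I) :
    IsProfile a b (fun x => modicaPrimitive D G α (U x)) (fun x => G (U x))
      (fun x => D (U x) * U' x) := by
  have hc : ContinuousOn U (Icc a b) := fun x hx => (hU x hx).continuousAt.continuousWithinAt
  exact ⟨fun x hx => ((hB.hasDerivAt_modica (hI hx)).comp x (hU x hx)).congr_deriv (by ring),
    fun x hx => hB.G_nonneg (hI hx), hB.contG.comp hc hI, (hB.contD.comp hc hI).mul hUd⟩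

/-- Variational lower bounds for the energy of functions `L¹`-close to a step function `v`. -/
theorem exists_energy_lower_bounds (hB : IsBistable I D f G α β) {lam γ₀ : ℝ}
    (hfα : 0 < deriv f α) (hfβ : 0 < deriv f β)
    (hlam : lam = min (deriv f α / D α) (deriv f β / D β))
    (hγ₀ : γ₀ = ∫ s in α..β, √(2 * G s) * D s)
    {a b r : ℝ} (hab : a < b) (hr : 0 < r) {N : ℕ} {h : Fin N → ℝ}
    (hsep : ∀ i j : Fin N, i < j → h i + r < h j - r)
    (hha : ∀ i, a ≤ h i - r) (hhb : ∀ i, h i + r ≤ b) {v : ℝ → ℝ}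
    (hvval : ∀ x ∈ Icc a b, v x = α ∨ v x = β)
    (hvconst : ∀ x ∈ Icc a b, ∀ y ∈ Icc a b, x ≤ y → (∀ i, ¬(x ≤ h i ∧ h i ≤ y)) → v x = v y)
    (hvjump : ∀ i, v (h i - r) ≠ v (h i + r)) {A : ℝ} (hAr : A < r * √(2 * lam))
    {k₁ k₂ : ℝ} (hk₁ : k₁ < α) (hk₂ : β < k₂) (hk : Icc k₁ k₂ ⊆ I) :
    ∃ δ > 0, ∃ η > 0, ∀ ε > 0, ∀ U U' : ℝ → ℝ,
      (∀ x ∈ Icc a b, HasDerivAt U (U' x) x) → ContinuousOn U' (Icc a b) →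
      (∀ x ∈ Icc a b, U x ∈ Icc k₁ k₂) → ∫ x in a..b, |U x - v x| < δ →
      N * γ₀ * (1 - 2 * Real.exp (-A / ε))
        ≤ ∫ x in a..b, (ε / 2 * (D (U x) * U' x) ^ 2 + G (U x) / ε) ∧
      ((∃ x ∈ Icc a b, U x = k₁ ∨ U x = k₂) → N * γ₀ + η
        ≤ ∫ x in a..b, (ε / 2 * (D (U x) * U' x) ^ 2 + G (U x) / ε)) := by
  set Ψ := modicaPrimitive D G α with hΨ
  have hΨα : Ψ α = 0 := modica_left
  have hΨβ : Ψ β = γ₀ := hγ₀.symm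
  have hmono : StrictMonoOn Ψ I := hB.strictMonoOn_modica
  have hγpos : 0 < γ₀ := by
    rw [← hΨβ, ← hΨα]
    exact hmono hB.left_mem hB.right_mem hB.lt
  have hDα := hB.posD α hB.left_mem
  have hDβ := hB.posD β hB.right_mem
  have hlampos : 0 < lam := by rw [hlam]; exact lt_min (by positivity) (by positivity)
  set μ := 2 / 3 * √(2 * lam) with hμ
  have hμ0 : 0 ≤ μ := by positivity
  have hμsq : μ ^ 2 < lam := by
    rw [hμ, mul_pow, Real.sq_sqrt (by positivity)]
    linarith
  have hμα : μ ^ 2 * D α < deriv f α := by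
    rw [← lt_div_iff₀ hDα]
    exact hμsq.trans_le (hlam ▸ min_le_left _ _)
  have hμβ : μ ^ 2 * D β < deriv f β := by
    rw [← lt_div_iff₀ hDβ]
    exact hμsq.trans_le (hlam ▸ min_le_right _ _)
  obtain ⟨κα, hκα, hwα⟩ := hB.exists_well_threshold hB.left_mem hB.zero_left hB.G_left hμ0 hμα
  obtain ⟨κβ, hκβ, hwβ⟩ := hB.exists_well_threshold hB.right_mem hB.zero_right hB.G_right hμ0 hμβ
  set κ := min κα κβ with hκ
  have hκpos : 0 < κ := lt_min hκα hκβ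
  have hk₁I : k₁ ∈ I := hk ⟨le_rfl, by linarith [hB.lt]⟩
  have hk₂I : k₂ ∈ I := hk ⟨by linarith [hB.lt], le_rfl⟩
  set c := min (Ψ k₂ - Ψ β) (Ψ α - Ψ k₁) with hc
  have hcpos : 0 < c := lt_min (sub_pos.2 (hmono hB.right_mem hk₂I hk₂))
    (sub_pos.2 (hmono hk₁I hB.left_mem hk₁))
  set κ' := min (κ / 2) (c / (2 * (2 * N + 1))) with hκ'
  have hκ'pos : 0 < κ' := lt_min (by positivity) (by positivity)
  have hκ'c : (2 * N + 1) * κ' ≤ c / 2 := by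
    have h1 : κ' ≤ c / (2 * (2 * N + 1)) := min_le_right _ _
    rw [le_div_iff₀ (by positivity)] at h1
    linarith
  set ℓ := min (r / 8) ((b - a) / 2) with hℓ
  have hℓpos : 0 < ℓ := lt_min (by positivity) (by linarith)
  obtain ⟨ρ, hρ, hρα, hρβ⟩ : ∃ ρ > 0, (∀ s, |s - α| < ρ → |Ψ s - Ψ α| ≤ κ') ∧
      ∀ s, |s - β| < ρ → |Ψ s - Ψ β| ≤ κ' := by
    obtain ⟨ρ₁, h1, h1'⟩ := Metric.continuousAt_iff.1
      (hB.hasDerivAt_modica hB.left_mem).continuousAt κ' hκ'pos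
    obtain ⟨ρ₂, h2, h2'⟩ := Metric.continuousAt_iff.1
      (hB.hasDerivAt_modica hB.right_mem).continuousAt κ' hκ'pos
    exact ⟨min ρ₁ ρ₂, lt_min h1 h2, fun s hs => (h1' (hs.trans_le (min_le_left _ _))).le,
      fun s hs => (h2' (hs.trans_le (min_le_right _ _))).le⟩
  refine ⟨ℓ * ρ, by positivity, c / 2, by positivity, fun ε hε U U' hU hU' hUk hδ => ?_⟩
  have hUI : MapsTo U (Icc a b) I := fun x hx => hk (hUk x hx)
  have hP := hB.isProfile hU hU' hUI
  have hvint : IntervalIntegrable v volume a b :=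
    intervalIntegrable_of_const_off_finite hab.le (C := max |α| |β|) (fun x hx => by
      rcases hvval x hx with hx | hx <;> rw [hx] <;> simp) hvconst
  have hUc : ContinuousOn U (Icc a b) := fun x hx => (hU x hx).continuousAt.continuousWithinAt
  have hint : IntervalIntegrable (fun x => |U x - v x|) volume a b :=
    ((hUc.intervalIntegrable_of_Icc hab.le).sub hvint).abs
  have hL : IsLayered a b r ℓ γ₀ κ' h (fun x => Ψ (U x)) (fun x => Ψ (v x)) := by
    refine ⟨hsep, hha, hhb, fun x hx => ?_, fun i x y hx hxi hiy hy => ?_, hℓpos, ?_, ?_,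
      fun x y hx hy hxy => ?_⟩
    · rcases hvval x hx with h | h <;> rw [h]
      · exact Or.inl hΨα
      · exact Or.inr hΨβ
    · have hne := jump_of_const_off hr hsep hha hhb hvconst hvjump i hx hxi hiy hy
      have hmem : ∀ z ∈ Icc a b, v z ∈ I := fun z hz => by
        rcases hvval z hz with h | h <;> rw [h]
        exacts [hB.left_mem, hB.right_mem]
      have := hha i
      have := hhb i
      exact fun e => hne (hmono.injOn (hmem x ⟨by linarith, by linarith⟩)
        (hmem y ⟨by linarith, by linarith⟩) e)
    · have : ℓ ≤ r / 8 := min_le_left _ _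
      linarith
    · have : ℓ ≤ (b - a) / 2 := min_le_right _ _
      linarith
    · obtain ⟨z, hz, hzρ⟩ := exists_abs_sub_lt hℓpos hρ hint hδ hx hy hxy
      refine ⟨z, hz, ?_⟩
      rcases hvval z ⟨hx.trans hz.1, hz.2.trans hy⟩ with h | h <;> rw [h] at hzρ ⊢
      exacts [hρα _ hzρ, hρβ _ hzρ]
  constructor
  · have hlow := hL.energy_ge hP hε hab.le hμ0 hγpos.le (κ := κ) (min_le_left _ _)
      (fun w hw x hx hxκ => by
        rcases hw with rfl | rfl
        · have := hwα (U x) (hUI hx)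
          rw [← hΨ, hΨα] at this
          exact this (hxκ.trans (min_le_left _ _))
        · have := hwβ (U x) (hUI hx)
          rw [← hΨ, hΨβ] at this
          exact this (hxκ.trans (min_le_right _ _)))
    refine le_trans ?_ hlow
    rw [mul_assoc, mul_comm γ₀]
    gcongr
    refine le_trans ?_ (one_sub_two_mul_exp_le_tanh _)
    gcongr
    rw [← mul_div_assoc, ← neg_div, hμ]
    gcongr
    linarith
  · rintro ⟨x, hx, hxk⟩
    refine hL.energy_ge_of_exit hP hε hγpos.le hκ'pos.le hκ'c hx ?_
    rcases hxk with e | e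
    · left
      have : c ≤ Ψ α - Ψ k₁ := min_le_right _ _
      simp only [e]
      linarith
    · right
      have : c ≤ Ψ k₂ - Ψ β := min_le_left _ _
      simp only [e]
      linarith

end IsBistable
lemma continuousOn_intervalIntegral {p q a b : ℝ} (hpq : p ≤ q) (hab : a ≤ b) {F : ℝ → ℝ → ℝ}
    (hF : ContinuousOn (fun z : ℝ × ℝ => F z.1 z.2) (Icc p q ×ˢ Icc a b)) :
    ContinuousOn (fun t => ∫ x in a..b, F t x) (Icc p q) := by
  have hc : Continuous fun t => ∫ x in a..b, F (projIcc p q hpq t) (projIcc a b hab x) := by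
    refine intervalIntegral.continuous_parametric_intervalIntegral_of_continuous' ?_ a b
    refine hF.comp_continuous (f := fun z : ℝ × ℝ =>
      ((projIcc p q hpq z.1 : ℝ), (projIcc a b hab z.2 : ℝ))) (by fun_prop) fun z => ?_
    exact ⟨(projIcc p q hpq z.1).2, (projIcc a b hab z.2).2⟩
  refine hc.continuousOn.congr fun t ht => ?_
  refine intervalIntegral.integral_congr fun x hx => ?_
  rw [uIcc_of_le hab] at hx
  simp only [projIcc_of_mem hpq ht, projIcc_of_mem hab hx]

lemma continuousOn_slice {p q a b t : ℝ} {F : ℝ → ℝ → ℝ} (ht : t ∈ Icc p q)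
    (hF : ContinuousOn (fun z : ℝ × ℝ => F z.1 z.2) (Icc p q ×ˢ Icc a b)) :
    ContinuousOn (F t) (Icc a b) :=
  hF.comp (f := fun x => (t, x)) (by fun_prop) fun _ hx => ⟨ht, hx⟩

/-- Differentiation under the integral sign at a time where the first factor vanishes. -/
lemma hasDerivAt_integral_sub_mul {p q a b t : ℝ} (ht : t ∈ Ioo p q) (hab : a ≤ b)
    {φ φt ψ : ℝ → ℝ → ℝ}
    (hφ : ∀ s ∈ Icc p q, ∀ x ∈ Icc a b, HasDerivAt (fun s => φ s x) (φt s x) s)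
    (hφc : ContinuousOn (fun z : ℝ × ℝ => φ z.1 z.2) (Icc p q ×ˢ Icc a b))
    (hφtc : ContinuousOn (fun z : ℝ × ℝ => φt z.1 z.2) (Icc p q ×ˢ Icc a b))
    (hψc : ContinuousOn (fun z : ℝ × ℝ => ψ z.1 z.2) (Icc p q ×ˢ Icc a b)) :
    HasDerivAt (fun s => ∫ x in a..b, (φ s x - φ t x) * ψ s x)
      (∫ x in a..b, φt t x * ψ t x) t := by
  have htI : t ∈ Icc p q := Ioo_subset_Icc_self ht
  have hK : IsCompact (Icc p q ×ˢ Icc a b) := isCompact_Icc.prod isCompact_Icc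
  obtain ⟨M, hM⟩ := hK.exists_bound_of_continuousOn hφtc
  obtain ⟨M', hM'⟩ := hK.exists_bound_of_continuousOn hψc
  have hnear : ∀ᶠ s in nhdsWithin t {t}ᶜ, s ∈ Icc p q :=
    mem_nhdsWithin_of_mem_nhds (Icc_mem_nhds ht.1 ht.2)
  rw [hasDerivAt_iff_tendsto_slope]
  have hmain : Tendsto (fun s => ∫ x in a..b, slope (fun s => φ s x) t s * ψ s x)
      (nhdsWithin t {t}ᶜ) (nhds (∫ x in a..b, φt t x * ψ t x)) := by
    refine intervalIntegral.tendsto_integral_filter_of_dominated_convergence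
      (fun _ => M * M') ?_ ?_ intervalIntegrable_const ?_
    · filter_upwards [hnear] with s hs
      refine ContinuousOn.aestronglyMeasurable ?_ measurableSet_uIoc
      rw [uIoc_of_le hab]
      refine ContinuousOn.mono ?_ Ioc_subset_Icc_self
      simp only [slope_def_field]
      exact (((continuousOn_slice hs hφc).sub (continuousOn_slice htI hφc)).div_const _).mul
        (continuousOn_slice hs hψc)
    · filter_upwards [hnear, self_mem_nhdsWithin] with s hs hst
      refine Eventually.of_forall fun x hx => ?_
      rw [uIoc_of_le hab] at hx
      have hx' := Ioc_subset_Icc_self hx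
      have h1 : ‖φ s x - φ t x‖ ≤ M * ‖s - t‖ :=
        (convex_Icc p q).norm_image_sub_le_of_norm_hasDerivWithin_le
          (f := fun s => φ s x) (fun τ hτ => (hφ τ hτ x hx').hasDerivWithinAt)
          (fun τ hτ => hM (τ, x) ⟨hτ, hx'⟩) htI hs
      have h2 := hM' (s, x) ⟨hs, hx'⟩
      have hpos : 0 < ‖s - t‖ := norm_pos_iff.2 (sub_ne_zero.2 hst)
      have h3 : ‖slope (fun s => φ s x) t s‖ ≤ M := by
        rw [slope_def_field, norm_div, div_le_iff₀ hpos]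
        exact h1
      rw [norm_mul]
      exact mul_le_mul h3 h2 (norm_nonneg _) ((norm_nonneg _).trans h3)
    · refine Eventually.of_forall fun x hx => ?_
      rw [uIoc_of_le hab] at hx
      have hx' := Ioc_subset_Icc_self hx
      refine (hasDerivAt_iff_tendsto_slope.1 (hφ t htI x hx')).mul ?_
      have hc : ContinuousWithinAt (fun s => ψ s x) (Icc p q) t :=
        (hψc.comp (f := fun s => (s, x)) (by fun_prop) fun _ hs => ⟨hs, hx'⟩) t htI
      exact (hc.continuousAt (Icc_mem_nhds ht.1 ht.2)).tendsto.mono_left nhdsWithin_le_nhds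
  refine hmain.congr fun s => ?_
  rw [slope_def_field]
  simp only [sub_self, zero_mul, intervalIntegral.integral_zero, sub_zero]
  rw [← intervalIntegral.integral_div]
  refine intervalIntegral.integral_congr fun x _ => ?_
  simp only [slope_def_field]
  ring

/-- The `L¹` displacement of a curve of functions is controlled by its `L²`-in-time speed. -/
lemma integral_abs_sub_le {a b T e : ℝ} (hab : a ≤ b) (hT : 0 ≤ T) (he : 0 < e)
    {u ut : ℝ → ℝ → ℝ}
    (hut : ∀ t ≥ (0 : ℝ), ∀ x ∈ Icc a b, HasDerivAt (fun s => u s x) (ut t x) t)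
    (hc : Continuous fun z : ℝ × ℝ => u z.1 z.2) (htc : Continuous fun z : ℝ × ℝ => ut z.1 z.2) :
    ∫ x in a..b, |u T x - u 0 x|
      ≤ e * T * (b - a) / 2 + (∫ t in (0 : ℝ)..T, ∫ x in a..b, ut t x ^ 2) / (2 * e) := by
  have hut' : ∀ t, Continuous fun x => ut x t := fun t =>
    htc.comp (by fun_prop : Continuous fun s : ℝ => (s, t))
  have hlin {g : ℝ → ℝ} (hg : Continuous g) {y z c k : ℝ} :
      ∫ x in y..z, (c + g x / k) = c * (z - y) + (∫ x in y..z, g x) / k := by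
    rw [intervalIntegral.integral_add (by simp) ((hg.div_const _).intervalIntegrable _ _),
      intervalIntegral.integral_div, intervalIntegral.integral_const, smul_eq_mul, mul_comm c]
  have hpt : ∀ x ∈ Icc a b,
      |u T x - u 0 x| ≤ e * T / 2 + (∫ t in (0 : ℝ)..T, ut t x ^ 2) / (2 * e) := by
    intro x hx
    have h1 : ∫ t in (0 : ℝ)..T, ut t x = u T x - u 0 x := by
      refine intervalIntegral.integral_eq_sub_of_hasDerivAt (f := fun s => u s x)
        (fun t ht => hut t ?_ x hx) ((hut' x).intervalIntegrable _ _)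
      rw [uIcc_of_le hT] at ht
      exact ht.1
    rw [← h1]
    refine (intervalIntegral.abs_integral_le_integral_abs hT).trans ?_
    have h2 : ∫ t in (0 : ℝ)..T, (e / 2 + ut t x ^ 2 / (2 * e))
        = e * T / 2 + (∫ t in (0 : ℝ)..T, ut t x ^ 2) / (2 * e) := by
      rw [hlin (g := fun t => ut t x ^ 2) ((hut' x).pow 2)]
      ring
    rw [← h2]
    refine intervalIntegral.integral_mono_on hT ((hut' x).abs.intervalIntegrable _ _)
      ((continuous_const.add (((hut' x).pow 2).div_const _)).intervalIntegrable _ _) fun t _ => ?_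
    rw [div_add_div _ _ two_ne_zero (by positivity), le_div_iff₀ (by positivity)]
    nlinarith [sq_nonneg (|ut t x| - e), sq_abs (ut t x)]
  have hsq : Continuous fun z : ℝ × ℝ => ut z.1 z.2 ^ 2 := htc.pow 2
  have hinner : Continuous fun x => ∫ t in (0 : ℝ)..T, ut t x ^ 2 :=
    intervalIntegral.continuous_parametric_intervalIntegral_of_continuous'
      (f := fun x t => ut t x ^ 2) (hsq.comp (by fun_prop : Continuous fun z : ℝ × ℝ => (z.2, z.1)))
      0 T
  have hswap : ∫ x in a..b, ∫ t in (0 : ℝ)..T, ut t x ^ 2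
      = ∫ t in (0 : ℝ)..T, ∫ x in a..b, ut t x ^ 2 := by
    refine intervalIntegral_intervalIntegral_swap (F := fun x t => ut t x ^ 2) ?_
    have hI : IntegrableOn (fun z : ℝ × ℝ => ut z.2 z.1 ^ 2) (uIcc a b ×ˢ uIcc 0 T)
        (volume.prod volume) :=
      (hsq.comp (by fun_prop : Continuous fun z : ℝ × ℝ => (z.2, z.1))).continuousOn
        |>.integrableOn_compact (isCompact_uIcc.prod isCompact_uIcc)
    exact hI.mono_set (prod_mono uIoc_subset_uIcc uIoc_subset_uIcc)
  calc ∫ x in a..b, |u T x - u 0 x|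
      ≤ ∫ x in a..b, (e * T / 2 + (∫ t in (0 : ℝ)..T, ut t x ^ 2) / (2 * e)) := by
        refine intervalIntegral.integral_mono_on hab ?_ ?_ hpt
        · exact Continuous.intervalIntegrable
            ((hc.comp (by fun_prop : Continuous fun x : ℝ => (T, x))).sub
              (hc.comp (by fun_prop : Continuous fun x : ℝ => ((0 : ℝ), x)))).abs _ _
        · exact (continuous_const.add (hinner.div_const _)).intervalIntegrable _ _
    _ = _ := by
        rw [hlin hinner, hswap]
        ring

/-- A classical solution of the Neumann problem `u_t = ε² (D(u) u_x)_x - f(u)` on `[a, b]`. -/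
structure IsNeumannSolution (D f : ℝ → ℝ) (a b ε : ℝ) (u ut ux w : ℝ → ℝ → ℝ) : Prop where
  deriv_x : ∀ t ≥ (0 : ℝ), ∀ x ∈ Icc a b, HasDerivAt (fun y => u t y) (ux t x) x
  deriv_t : ∀ t ≥ (0 : ℝ), ∀ x ∈ Icc a b, HasDerivAt (fun s => u s x) (ut t x) t
  deriv_flux : ∀ t ≥ (0 : ℝ), ∀ x ∈ Icc a b,
    HasDerivAt (fun y => D (u t y) * ux t y) (w t x) x
  pde : ∀ t > (0 : ℝ), ∀ x ∈ Icc a b, ut t x = ε ^ 2 * w t x - f (u t x)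
  neumann : ∀ t ≥ (0 : ℝ), ux t a = 0 ∧ ux t b = 0
  cont : Continuous fun z : ℝ × ℝ => u z.1 z.2
  cont_t : Continuous fun z : ℝ × ℝ => ut z.1 z.2
  cont_x : Continuous fun z : ℝ × ℝ => ux z.1 z.2

namespace IsNeumannSolution

variable {I : Set ℝ} {D f G : ℝ → ℝ} {α β a b ε p q T : ℝ} {u ut ux w : ℝ → ℝ → ℝ}

lemma continuousOn_comp (hu : IsNeumannSolution D f a b ε u ut ux w) {g : ℝ → ℝ}
    (hg : ContinuousOn g I) (hI : ∀ t ∈ Icc p q, ∀ x ∈ Icc a b, u t x ∈ I) :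
    ContinuousOn (fun z : ℝ × ℝ => g (u z.1 z.2)) (Icc p q ×ˢ Icc a b) :=
  hg.comp hu.cont.continuousOn fun z hz => hI z.1 hz.1 z.2 hz.2

lemma continuousOn_density (hu : IsNeumannSolution D f a b ε u ut ux w)
    (hB : IsBistable I D f G α β) (hI : ∀ t ∈ Icc p q, ∀ x ∈ Icc a b, u t x ∈ I) :
    ContinuousOn (fun z : ℝ × ℝ => ε / 2 * (D (u z.1 z.2) * ux z.1 z.2) ^ 2 + G (u z.1 z.2) / ε)
      (Icc p q ×ˢ Icc a b) :=
  (continuousOn_const.mul (((hu.continuousOn_comp hB.contD hI).mul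
    hu.cont_x.continuousOn).pow 2)).add ((hu.continuousOn_comp hB.contG hI).div_const _)

lemma continuousOn_dissipation (hu : IsNeumannSolution D f a b ε u ut ux w)
    (hB : IsBistable I D f G α β) (hI : ∀ t ∈ Icc p q, ∀ x ∈ Icc a b, u t x ∈ I) :
    ContinuousOn (fun z : ℝ × ℝ => D (u z.1 z.2) * ut z.1 z.2 ^ 2) (Icc p q ×ˢ Icc a b) :=
  (hu.continuousOn_comp hB.contD hI).mul (hu.cont_t.pow 2).continuousOn

/-- Integration by parts for the difference of the gradient energies at two times. -/
lemma integral_flux_sq_sub (hu : IsNeumannSolution D f a b ε u ut ux w)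
    (hB : IsBistable I D f G α β) (hε : 0 < ε) (hab : a ≤ b) {s t : ℝ} (hs : 0 < s) (ht : 0 < t)
    (hIs : ∀ x ∈ Icc a b, u s x ∈ I) (hIt : ∀ x ∈ Icc a b, u t x ∈ I) {P : ℝ → ℝ}
    (hP : ∀ z ∈ I, HasDerivAt P (D z) z) :
    ∫ x in a..b, ((D (u s x) * ux s x) ^ 2 - (D (u t x) * ux t x) ^ 2)
      = -∫ x in a..b, (P (u s x) - P (u t x)) *
        ((ut s x + f (u s x)) / ε ^ 2 + (ut t x + f (u t x)) / ε ^ 2) := by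
  have hw : ∀ τ > 0, ∀ x ∈ Icc a b, w τ x = (ut τ x + f (u τ x)) / ε ^ 2 := by
    intro τ hτ x hx
    rw [hu.pde τ hτ x hx]
    field_simp
    ring
  have hcw : ∀ τ, (∀ x ∈ Icc a b, u τ x ∈ I) →
      ContinuousOn (fun x => (ut τ x + f (u τ x)) / ε ^ 2) (Icc a b) := by
    intro τ hτ
    have h1 : Continuous fun x => ut τ x :=
      hu.cont_t.comp (by fun_prop : Continuous fun x : ℝ => (τ, x))
    have h2 : Continuous fun x => u τ x :=
      hu.cont.comp (by fun_prop : Continuous fun x : ℝ => (τ, x))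
    exact (h1.continuousOn.add (hB.smooth.continuousOn.comp h2.continuousOn hτ)).div_const _
  have hcQ : ∀ τ, (∀ x ∈ Icc a b, u τ x ∈ I) →
      ContinuousOn (fun x => D (u τ x) * ux τ x) (Icc a b) := by
    intro τ hτ
    have h1 : Continuous fun x => ux τ x :=
      hu.cont_x.comp (by fun_prop : Continuous fun x : ℝ => (τ, x))
    have h2 : Continuous fun x => u τ x :=
      hu.cont.comp (by fun_prop : Continuous fun x : ℝ => (τ, x))
    exact (hB.contD.comp h2.continuousOn hτ).mul h1.continuousOn
  have hQ : ∀ τ ≥ 0, ∀ x ∈ Icc a b, u τ x ∈ I →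
      HasDerivAt (fun y => P (u τ y)) (D (u τ x) * ux τ x) x := fun τ hτ x hx hI =>
    (hP _ hI).comp x (hu.deriv_x τ hτ x hx)
  have hw' : ∀ τ > 0, ∀ x ∈ Icc a b,
      HasDerivAt (fun y => D (u τ y) * ux τ y) ((ut τ x + f (u τ x)) / ε ^ 2) x :=
    fun τ hτ x hx => hw τ hτ x hx ▸ hu.deriv_flux τ hτ.le x hx
  have hparts := intervalIntegral.integral_mul_deriv_eq_deriv_mul (a := a) (b := b)
    (u := fun x => D (u s x) * ux s x + D (u t x) * ux t x)
    (v := fun x => P (u s x) - P (u t x))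
    (u' := fun x => (ut s x + f (u s x)) / ε ^ 2 + (ut t x + f (u t x)) / ε ^ 2)
    (v' := fun x => D (u s x) * ux s x - D (u t x) * ux t x)
    (fun x hx => by
      rw [uIcc_of_le hab] at hx
      exact (hw' s hs x hx).add (hw' t ht x hx))
    (fun x hx => by
      rw [uIcc_of_le hab] at hx
      exact (hQ s hs.le x hx (hIs x hx)).sub (hQ t ht.le x hx (hIt x hx)))
    (((hcw s hIs).add (hcw t hIt)).intervalIntegrable_of_Icc hab)
    (((hcQ s hIs).sub (hcQ t hIt)).intervalIntegrable_of_Icc hab)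
  simp only [(hu.neumann s hs.le).1, (hu.neumann s hs.le).2, (hu.neumann t ht.le).1,
    (hu.neumann t ht.le).2, mul_zero, add_zero, zero_mul, sub_zero, zero_sub] at hparts
  rw [show (fun x => (P (u s x) - P (u t x)) *
      ((ut s x + f (u s x)) / ε ^ 2 + (ut t x + f (u t x)) / ε ^ 2)) = fun x =>
      ((ut s x + f (u s x)) / ε ^ 2 + (ut t x + f (u t x)) / ε ^ 2) * (P (u s x) - P (u t x))
    from funext fun x => mul_comm _ _, ← hparts]
  exact intervalIntegral.integral_congr fun x _ => by ring

/-- The energy identity in differential form. -/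
lemma hasDerivAt_energy (hu : IsNeumannSolution D f a b ε u ut ux w)
    (hB : IsBistable I D f G α β) (hε : 0 < ε) (hab : a ≤ b) (hp : 0 < p) {t : ℝ}
    (ht : t ∈ Ioo p q) (hI : ∀ t ∈ Icc p q, ∀ x ∈ Icc a b, u t x ∈ I) :
    HasDerivAt
      (fun s => ∫ x in a..b, (ε / 2 * (D (u s x) * ux s x) ^ 2 + G (u s x) / ε))
      (-(∫ x in a..b, D (u t x) * ut t x ^ 2) / ε) t := by
  obtain ⟨P, hP⟩ : ∃ P : ℝ → ℝ, ∀ z ∈ I, HasDerivAt P (D z) z :=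
    ⟨_, fun z hz => hasDerivAt_integral_of_continuousOn hB.isOpen hB.ordConnected hB.contD
      hB.left_mem hz⟩
  have htI := Ioo_subset_Icc_self ht
  have hpos : ∀ s ∈ Icc p q, 0 < s := fun s hs => hp.trans_le hs.1
  have hPc : ContinuousOn P I := fun z hz => (hP z hz).continuousAt.continuousWithinAt
  have hcu {g : ℝ → ℝ} (hg : ContinuousOn g I) := hu.continuousOn_comp hg hI
  have hfc := hB.smooth.continuousOn
  have hct : ContinuousOn (fun z : ℝ × ℝ => ut z.1 z.2) (Icc p q ×ˢ Icc a b) :=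
    hu.cont_t.continuousOn
  have hcv : ContinuousOn (fun z : ℝ × ℝ => (ut z.1 z.2 + f (u z.1 z.2)) / ε ^ 2)
      (Icc p q ×ˢ Icc a b) := (hct.add (hcu hfc)).div_const _
  have hgrad := hasDerivAt_integral_sub_mul (φ := fun s x => P (u s x))
    (φt := fun s x => D (u s x) * ut s x)
    (ψ := fun s x => (ut s x + f (u s x)) / ε ^ 2 + (ut t x + f (u t x)) / ε ^ 2) ht hab
    (fun s hs x hx => (hP _ (hI s hs x hx)).comp s (hu.deriv_t s (hpos s hs).le x hx))
    (hcu hPc) ((hcu hB.contD).mul hct)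
    (hcv.add (hcv.comp (f := fun z : ℝ × ℝ => (t, z.2)) (by fun_prop)
      fun z hz => ⟨htI, hz.2⟩))
  have hpot := hasDerivAt_integral_sub_mul (φ := fun s x => G (u s x))
    (φt := fun s x => f (u s x) * D (u s x) * ut s x) (ψ := fun _ _ => 1) ht hab
    (fun s hs x hx => (hB.hasDerivAt_G (hI s hs x hx)).comp s
      (hu.deriv_t s (hpos s hs).le x hx))
    (hcu hB.contG) (((hcu hfc).mul (hcu hB.contD)).mul hct) continuousOn_const
  have hsum := (((hgrad.const_mul (-(ε / 2))).add (hpot.const_mul ε⁻¹)).const_add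
    (∫ x in a..b, (ε / 2 * (D (u t x) * ux t x) ^ 2 + G (u t x) / ε)))
  have hint {F : ℝ → ℝ → ℝ} (hF : ContinuousOn (fun z : ℝ × ℝ => F z.1 z.2)
      (Icc p q ×ˢ Icc a b)) {s : ℝ} (hs : s ∈ Icc p q) : IntervalIntegrable (F s) volume a b :=
    (continuousOn_slice hs hF).intervalIntegrable_of_Icc hab
  have hcflux : ContinuousOn (fun z : ℝ × ℝ => (D (u z.1 z.2) * ux z.1 z.2) ^ 2)
      (Icc p q ×ˢ Icc a b) := ((hcu hB.contD).mul hu.cont_x.continuousOn).pow 2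
  refine (hsum.congr_of_eventuallyEq ?_).congr_deriv ?_
  · filter_upwards [Icc_mem_nhds ht.1 ht.2] with s hs
    have hibp := hu.integral_flux_sq_sub hB hε hab (hpos s hs) (hpos t htI) (hI s hs) (hI t htI) hP
    have hG1 : ∫ x in a..b, (G (u s x) - G (u t x)) * 1
        = (∫ x in a..b, G (u s x)) - ∫ x in a..b, G (u t x) := by
      simp only [mul_one]
      exact intervalIntegral.integral_sub (hint (F := fun s x => G (u s x)) (hcu hB.contG) hs)
        (hint (F := fun s x => G (u s x)) (hcu hB.contG) htI)
    have hE : ∀ τ ∈ Icc p q, ∫ x in a..b, (ε / 2 * (D (u τ x) * ux τ x) ^ 2 + G (u τ x) / ε)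
        = ε / 2 * (∫ x in a..b, (D (u τ x) * ux τ x) ^ 2) + (∫ x in a..b, G (u τ x)) / ε := by
      intro τ hτ
      rw [intervalIntegral.integral_add, intervalIntegral.integral_const_mul,
        intervalIntegral.integral_div]
      · exact (hint (F := fun s x => (D (u s x) * ux s x) ^ 2) hcflux hτ).const_mul _
      · exact (hint (F := fun s x => G (u s x)) (hcu hB.contG) hτ).div_const _
    rw [intervalIntegral.integral_sub (hint (F := fun s x => (D (u s x) * ux s x) ^ 2) hcflux hs)
      (hint (F := fun s x => (D (u s x) * ux s x) ^ 2) hcflux htI)] at hibp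
    simp only [Pi.add_apply]
    rw [hE s hs, hE t htI, hG1, ← neg_eq_iff_eq_neg.2 hibp]
    ring
  · rw [← intervalIntegral.integral_const_mul, ← intervalIntegral.integral_const_mul,
      ← intervalIntegral.integral_add, neg_div, ← intervalIntegral.integral_div,
      ← intervalIntegral.integral_neg]
    · refine intervalIntegral.integral_congr fun x _ => ?_
      field_simp
      ring
    · exact ((hint (F := fun s x => D (u s x) * ut s x *
        ((ut s x + f (u s x)) / ε ^ 2 + (ut s x + f (u s x)) / ε ^ 2))
        (((hcu hB.contD).mul hct).mul (hcv.add hcv)) htI)).const_mul _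
    · exact ((hint (F := fun s x => f (u s x) * D (u s x) * ut s x * 1)
        ((((hcu hfc).mul (hcu hB.contD)).mul hct).mul continuousOn_const) htI)).const_mul _

/-- The energy identity bounds the `L²`-in-time speed of the solution. -/
lemma energy_add_dissipation_le (hu : IsNeumannSolution D f a b ε u ut ux w)
    (hB : IsBistable I D f G α β) (hε : 0 < ε) (hab : a ≤ b) (hT : 0 ≤ T) {d : ℝ}
    (hd : ∀ s ∈ I, d ≤ D s) (hI : ∀ t ∈ Icc 0 T, ∀ x ∈ Icc a b, u t x ∈ I) :
    (∫ x in a..b, (ε / 2 * (D (u T x) * ux T x) ^ 2 + G (u T x) / ε))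
        + d * (∫ t in (0 : ℝ)..T, ∫ x in a..b, ut t x ^ 2) / ε
      ≤ ∫ x in a..b, (ε / 2 * (D (u 0 x) * ux 0 x) ^ 2 + G (u 0 x) / ε) := by
  have hcE := continuousOn_intervalIntegral hT hab
    (F := fun t x => ε / 2 * (D (u t x) * ux t x) ^ 2 + G (u t x) / ε)
    (hu.continuousOn_density hB hI)
  have hdis := hu.continuousOn_dissipation hB hI
  have hcd := continuousOn_intervalIntegral hT hab (F := fun t x => D (u t x) * ut t x ^ 2) hdis
  have hsq : ContinuousOn (fun z : ℝ × ℝ => ut z.1 z.2 ^ 2) (Icc 0 T ×ˢ Icc a b) :=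
    (hu.cont_t.pow 2).continuousOn
  have hcs := continuousOn_intervalIntegral hT hab (F := fun t x => ut t x ^ 2) hsq
  have hftc := intervalIntegral.integral_eq_sub_of_hasDerivAt_of_le hT hcE (fun t ht => by
    refine hu.hasDerivAt_energy hB hε hab (p := t / 2) (q := T) (by linarith [ht.1])
      ⟨by linarith [ht.1], ht.2⟩ fun τ hτ => hI τ ⟨?_, hτ.2⟩
    linarith [hτ.1, ht.1])
    ((hcd.neg.div_const ε).intervalIntegrable_of_Icc hT)
  simp only [Pi.neg_apply, intervalIntegral.integral_div, intervalIntegral.integral_neg] at hftc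
  have hmono : d * (∫ t in (0 : ℝ)..T, ∫ x in a..b, ut t x ^ 2)
      ≤ ∫ t in (0 : ℝ)..T, ∫ x in a..b, D (u t x) * ut t x ^ 2 := by
    rw [← intervalIntegral.integral_const_mul]
    refine intervalIntegral.integral_mono_on hT
      ((hcs.intervalIntegrable_of_Icc hT).const_mul _) (hcd.intervalIntegrable_of_Icc hT)
      fun t ht => ?_
    rw [← intervalIntegral.integral_const_mul]
    refine intervalIntegral.integral_mono_on hab
      (((continuousOn_slice (F := fun t x => ut t x ^ 2) ht hsq).intervalIntegrable_of_Icc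
        hab).const_mul _)
      ((continuousOn_slice (F := fun t x => D (u t x) * ut t x ^ 2) ht
        hdis).intervalIntegrable_of_Icc hab) fun x hx => ?_
    exact mul_le_mul_of_nonneg_right (hd _ (hI t ht x hx)) (sq_nonneg _)
  have h := div_le_div_of_nonneg_right hmono hε.le
  rw [neg_div] at hftc
  linarith

end IsNeumannSolution

namespace IsNeumannSolution

variable {I : Set ℝ} {D f G : ℝ → ℝ} {α β a b ε T : ℝ} {u ut ux w : ℝ → ℝ → ℝ}

/-- A solution whose initial energy is nearly minimal among the functions close to `v` moves
slowly. -/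
theorem integral_abs_sub_initial_le (hu : IsNeumannSolution D f a b ε u ut ux w)
    (hB : IsBistable I D f G α β) (hε : 0 < ε) (hab : a ≤ b) {d : ℝ} (hd : 0 < d)
    (hdD : ∀ s ∈ I, d ≤ D s) {k₁ k₂ : ℝ} (hk : Icc k₁ k₂ ⊆ I) {v : ℝ → ℝ}
    (hv : IntervalIntegrable v volume a b) {δ η Γ ρ ρ₀ e : ℝ} (he : 0 < e) (hη : ρ₀ < η)
    (hlow : ∀ U U' : ℝ → ℝ, (∀ x ∈ Icc a b, HasDerivAt U (U' x) x) → ContinuousOn U' (Icc a b) →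
      (∀ x ∈ Icc a b, U x ∈ Icc k₁ k₂) → ∫ x in a..b, |U x - v x| < δ →
      Γ - ρ ≤ ∫ x in a..b, (ε / 2 * (D (U x) * U' x) ^ 2 + G (U x) / ε) ∧
      ((∃ x ∈ Icc a b, U x = k₁ ∨ U x = k₂) →
        Γ + η ≤ ∫ x in a..b, (ε / 2 * (D (U x) * U' x) ^ 2 + G (U x) / ε)))
    (hE : ∫ x in a..b, (ε / 2 * (D (u 0 x) * ux 0 x) ^ 2 + G (u 0 x) / ε) ≤ Γ + ρ₀)
    (h0 : ∀ x ∈ Icc a b, u 0 x ∈ Icc k₁ k₂) (h0v : ∫ x in a..b, |u 0 x - v x| < δ / 2)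
    (hsmall : e * T * (b - a) / 2 + ε * (ρ + ρ₀) / d / (2 * e) < δ / 2) :
    ∀ t ∈ Icc 0 T,
      ∫ x in a..b, |u t x - u 0 x| ≤ e * T * (b - a) / 2 + ε * (ρ + ρ₀) / d / (2 * e) := by
  set K := e * T * (b - a) / 2 + ε * (ρ + ρ₀) / d / (2 * e) with hK
  have hcu : ∀ t, Continuous fun x => u t x := fun t =>
    hu.cont.comp (by fun_prop : Continuous fun x : ℝ => (t, x))
  have hcL : Continuous fun t => ∫ x in a..b, |u t x - u 0 x| :=
    intervalIntegral.continuous_parametric_intervalIntegral_of_continuous'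
      (f := fun t x => |u t x - u 0 x|)
      (hu.cont.sub ((hcu 0).comp continuous_snd)).abs a b
  set P : Set ℝ := {t | ∀ x ∈ Icc a b, u t x ∈ Ioo k₁ k₂} ∩
    {t | ∫ x in a..b, |u t x - u 0 x| < δ / 2} with hPdef
  set Q : Set ℝ := {t | ∀ x ∈ Icc a b, u t x ∈ Icc k₁ k₂} ∩
    {t | ∫ x in a..b, |u t x - u 0 x| ≤ δ / 2} with hQdef
  have hP : IsOpen P := by
    refine IsOpen.inter (isOpen_iff_mem_nhds.2 fun t ht => ?_) (isOpen_lt hcL continuous_const)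
    exact isCompact_Icc.eventually_forall_of_forall_eventually fun x hx =>
      hu.cont.continuousAt.eventually (isOpen_Ioo.mem_nhds (ht x hx))
  have hQ : IsClosed Q := by
    refine IsClosed.inter ?_ (isClosed_le hcL continuous_const)
    simp only [ofPred_forall]
    exact isClosed_biInter fun x _ => isClosed_Icc.preimage
      (hu.cont.comp (by fun_prop : Continuous fun t : ℝ => (t, x)))
  have hstep : ∀ t ∈ Icc 0 T, Icc 0 t ⊆ Q →
      (∀ x ∈ Icc a b, u t x ∈ Ioo k₁ k₂) ∧ ∫ x in a..b, |u t x - u 0 x| ≤ K := by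
    intro t ht htQ
    have hQt := htQ (right_mem_Icc.2 ht.1)
    have hdiss := hu.energy_add_dissipation_le hB hε hab ht.1 hdD
      fun τ hτ x hx => hk ((htQ hτ).1 x hx)
    have hL := integral_abs_sub_le hab ht.1 he hu.deriv_t hu.cont hu.cont_t
    set X := ∫ t in (0 : ℝ)..t, ∫ x in a..b, ut t x ^ 2 with hX
    have hX0 : 0 ≤ X := intervalIntegral.integral_nonneg ht.1 fun _ _ =>
      intervalIntegral.integral_nonneg hab fun _ _ => sq_nonneg _
    have hclose : ∫ x in a..b, |u t x - v x| < δ := by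
      have hi1 : IntervalIntegrable (fun x => |u t x - u 0 x|) volume a b :=
        ((hcu t).sub (hcu 0)).abs.intervalIntegrable _ _
      have hi2 : IntervalIntegrable (fun x => |u 0 x - v x|) volume a b :=
        (((hcu 0).intervalIntegrable _ _).sub hv).abs
      have h1 : ∫ x in a..b, |u t x - v x|
          ≤ ∫ x in a..b, (|u t x - u 0 x| + |u 0 x - v x|) :=
        intervalIntegral.integral_mono_on hab
          ((((hcu t).intervalIntegrable _ _).sub hv).abs) (hi1.add hi2)
          fun x _ => abs_sub_le _ _ _
      rw [intervalIntegral.integral_add hi1 hi2] at h1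
      linarith [show ∫ x in a..b, |u t x - u 0 x| ≤ δ / 2 from hQt.2]
    obtain ⟨hmin, hexit⟩ := hlow (u t) (ux t) (hu.deriv_x t ht.1)
      (hu.cont_x.comp (by fun_prop : Continuous fun x : ℝ => (t, x))).continuousOn hQt.1 hclose
    have hdX : 0 ≤ d * X / ε := by positivity
    refine ⟨fun x hx => ?_, hL.trans ?_⟩
    · have hne : ¬(u t x = k₁ ∨ u t x = k₂) := fun h => by linarith [hexit ⟨x, hx, h⟩]
      rw [not_or] at hne
      exact ⟨lt_of_le_of_ne (hQt.1 x hx).1 (Ne.symm hne.1), lt_of_le_of_ne (hQt.1 x hx).2 hne.2⟩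
    · have hXle : X ≤ ε * (ρ + ρ₀) / d := by
        have h1 : d * X / ε ≤ ρ + ρ₀ := by linarith
        rw [div_le_iff₀ hε] at h1
        rw [le_div_iff₀ hd]
        linarith
      have hba : 0 ≤ b - a := sub_nonneg.2 hab
      rw [hK]
      gcongr
      exact ht.2
  have hQT : Icc 0 T ⊆ Q := by
    refine (hQ.inter isClosed_Icc).Icc_subset_of_forall_mem_nhdsGT_of_Icc_subset ⟨h0, ?_⟩
      fun t ht htQ => ?_
    · have hδ : 0 ≤ ∫ x in a..b, |u 0 x - v x| :=
        intervalIntegral.integral_nonneg hab fun _ _ => abs_nonneg _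
      have h00 : ∫ x in a..b, |u 0 x - u 0 x| = 0 := by simp
      exact h00.trans_le (by linarith)
    · obtain ⟨h1, h2⟩ := hstep t (Ico_subset_Icc_self ht) htQ
      refine mem_nhdsWithin_of_mem_nhds (mem_of_superset
        (hP.mem_nhds ⟨h1, h2.trans_lt hsmall⟩) fun s hs => ⟨fun x hx => ?_, ?_⟩)
      · exact Ioo_subset_Icc_self (hs.1 x hx)
      · exact le_of_lt (show ∫ x in a..b, |u s x - u 0 x| < δ / 2 from hs.2)
  exact fun t ht => (hstep t ht ((Icc_subset_Icc_right ht.2).trans hQT)).2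

end IsNeumannSolution

lemma tendsto_exp_neg_div_nhdsGT_zero {A : ℝ} (hA : 0 < A) :
    Tendsto (fun ε : ℝ => Real.exp (-A / ε)) (nhdsWithin 0 (Ioi 0)) (nhds 0) := by
  have h : Tendsto (fun ε : ℝ => -A * ε⁻¹) (nhdsWithin 0 (Ioi 0)) atBot :=
    tendsto_inv_nhdsGT_zero.const_mul_atTop_of_neg (neg_lt_zero.2 hA)
  exact Real.tendsto_exp_atBot.comp h

/-- An interval contained in an open order-connected set can be enlarged within it. -/
lemma exists_Icc_subset_of_isOpen {I : Set ℝ} (hI : IsOpen I) (hc : I.OrdConnected) {x y : ℝ}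
    (hx : x ∈ I) (hy : y ∈ I) : ∃ k₁ < x, ∃ k₂ > y, Icc k₁ k₂ ⊆ I := by
  obtain ⟨k₁, h₁, h₁I⟩ := ((eventually_mem_nhdsWithin (a := x) (s := Iio x)).and
    (mem_nhdsWithin_of_mem_nhds (hI.mem_nhds hx))).exists
  obtain ⟨k₂, h₂, h₂I⟩ := ((eventually_mem_nhdsWithin (a := y) (s := Ioi y)).and
    (mem_nhdsWithin_of_mem_nhds (hI.mem_nhds hy))).exists
  exact ⟨k₁, h₁, k₂, h₂, hc.out h₁I h₂I⟩

/-- Main metastability theorem: the solution maintains the `N`-transition layer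
structure of its initial datum for a time of order `exp(A/ε)`:
`sup_{0≤t≤m exp(A/ε)} ‖u^ε(·,t) - v‖_{L¹} → 0` as `ε → 0⁺`, for every `m > 0`; moreover `sup_{0≤t≤m exp(A/ε)} ‖u^ε(·,t) - u₀^ε‖_{L¹} ≤ C √ε` for small `ε`. -/
theorem stmt19
    (I : Set ℝ) (hIopen : IsOpen I) (hIconn : I.OrdConnected)
    (D f G : ℝ → ℝ) (d α β : ℝ) (hαβ : α < β) (hsub : Set.Icc α β ⊆ I)
    (hD : ContDiffOn ℝ 2 D I) (hd : 0 < d) (hDd : ∀ s ∈ I, d ≤ D s)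
    (hf : ContDiffOn ℝ 2 f I)
    (hfα : f α = 0) (hfβ : f β = 0)
    (hf'α : 0 < deriv f α) (hf'β : 0 < deriv f β)
    (hint0 : (∫ s in α..β, f s * D s) = 0)
    (hG : ∀ s, G s = ∫ z in α..s, f z * D z)
    (hGpos : ∀ s ∈ I, s ≠ α → s ≠ β → 0 < G s)
    (lam γ₀ : ℝ)
    (hlam : lam = min (deriv f α / D α) (deriv f β / D β))
    (hγ₀ : γ₀ = ∫ s in α..β, Real.sqrt (2 * G s) * D s)
    (a b r : ℝ) (hab : a < b) (hr : 0 < r)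
    (N : ℕ) (h : Fin N → ℝ) (hmono : StrictMono h)
    (hsep : ∀ i j : Fin N, i < j → h i + r < h j - r)
    (hha : ∀ i, a ≤ h i - r) (hhb : ∀ i, h i + r ≤ b)
    (v : ℝ → ℝ)
    (hvval : ∀ x ∈ Set.Icc a b, v x = α ∨ v x = β)
    (hvconst : ∀ x ∈ Set.Icc a b, ∀ y ∈ Set.Icc a b, x ≤ y →
      (∀ i, ¬(x ≤ h i ∧ h i ≤ y)) → v x = v y)
    (hvjump : ∀ i, v (h i - r) ≠ v (h i + r))
    (A : ℝ) (hA : 0 < A) (hAr : A < r * Real.sqrt (2 * lam))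
    (M₁ M₂ : ℝ) (hM : M₁ ≤ M₂) (hMsub : Set.Icc M₁ M₂ ⊆ I)
    -- the family of solutions `u ε t x` with derivatives `ut`, `ux` and `w = (D(u)u_x)_x`
    (u ut ux w : ℝ → ℝ → ℝ → ℝ)
    (hux : ∀ ε > (0:ℝ), ∀ t ≥ (0:ℝ), ∀ x ∈ Set.Icc a b,
      HasDerivAt (fun y => u ε t y) (ux ε t x) x)
    (hut : ∀ ε > (0:ℝ), ∀ t ≥ (0:ℝ), ∀ x ∈ Set.Icc a b,
      HasDerivAt (fun s => u ε s x) (ut ε t x) t)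
    (hw : ∀ ε > (0:ℝ), ∀ t ≥ (0:ℝ), ∀ x ∈ Set.Icc a b,
      HasDerivAt (fun y => D (u ε t y) * ux ε t y) (w ε t x) x)
    (hpde : ∀ ε > (0:ℝ), ∀ t > (0:ℝ), ∀ x ∈ Set.Icc a b,
      ut ε t x = ε ^ 2 * w ε t x - f (u ε t x))
    (hneu : ∀ ε > (0:ℝ), ∀ t ≥ (0:ℝ), ux ε t a = 0 ∧ ux ε t b = 0)
    (hreg : ∀ ε > (0:ℝ), Continuous fun p : ℝ × ℝ => u ε p.1 p.2)
    (hregt : ∀ ε > (0:ℝ), Continuous fun p : ℝ × ℝ => ut ε p.1 p.2)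
    (hregx : ∀ ε > (0:ℝ), Continuous fun p : ℝ × ℝ => ux ε p.1 p.2)
    -- the initial datum takes values in `[M₁,M₂] ⊂ I`
    (hval0 : ∀ ε > (0:ℝ), ∀ x ∈ Set.Icc a b, u ε 0 x ∈ Set.Icc M₁ M₂)
    -- `N`-transition layer structure of the initial datum
    (hL1 : Tendsto (fun ε => ∫ x in a..b, |u ε 0 x - v x|)
      (nhdsWithin 0 (Set.Ioi 0)) (nhds 0))
    (C₀ εa : ℝ) (hC₀ : 0 < C₀) (hεa : 0 < εa)
    (hE0 : ∀ ε ∈ Set.Ioo (0:ℝ) εa,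
      (∫ x in a..b, (ε / 2 * (D (u ε 0 x) * ux ε 0 x) ^ 2 + G (u ε 0 x) / ε)) ≤
        (N : ℝ) * γ₀ + C₀ * Real.exp (-A / ε)) :
    (∀ m > (0:ℝ),
      Tendsto (fun ε => ⨆ t ∈ Set.Icc (0:ℝ) (m * Real.exp (A / ε)),
          ∫ x in a..b, |u ε t x - v x|)
        (nhdsWithin 0 (Set.Ioi 0)) (nhds 0)) ∧
    ∀ m > (0:ℝ), ∃ C > (0:ℝ), ∃ ε₁ > (0:ℝ), ∀ ε ∈ Set.Ioo (0:ℝ) ε₁,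
      ∀ t ∈ Set.Icc (0:ℝ) (m * Real.exp (A / ε)),
        (∫ x in a..b, |u ε t x - u ε 0 x|) ≤ C * Real.sqrt ε := by
  have hB : IsBistable I D f G α β :=
    { isOpen := hIopen, ordConnected := hIconn, lt := hαβ, subset := hsub
      contD := hD.continuousOn, posD := fun s hs => hd.trans_le (hDd s hs)
      smooth := hf.of_le (by norm_num), zero_left := hfα, zero_right := hfβ
      balanced := hint0, potential := hG, pos := hGpos }
  have hu : ∀ ε > 0, IsNeumannSolution D f a b ε (u ε) (ut ε) (ux ε) (w ε) := fun ε hε =>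
    { deriv_x := hux ε hε, deriv_t := hut ε hε, deriv_flux := hw ε hε, pde := hpde ε hε
      neumann := hneu ε hε, cont := hreg ε hε, cont_t := hregt ε hε, cont_x := hregx ε hε }
  have hmin : min M₁ α ∈ I := by
    rcases min_choice M₁ α with h | h <;> rw [h]
    exacts [hMsub (left_mem_Icc.2 hM), hB.left_mem]
  have hmax : max M₂ β ∈ I := by
    rcases max_choice M₂ β with h | h <;> rw [h]
    exacts [hMsub (right_mem_Icc.2 hM), hB.right_mem]
  obtain ⟨k₁, hk₁, k₂, hk₂, hk⟩ := exists_Icc_subset_of_isOpen hIopen hIconn hmin hmax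
  obtain ⟨hk₁M, hk₁α⟩ := lt_min_iff.1 hk₁
  obtain ⟨hk₂M, hk₂β⟩ := max_lt_iff.1 hk₂
  obtain ⟨δ, hδ, η, hη, hlow⟩ := hB.exists_energy_lower_bounds hf'α hf'β hlam hγ₀ hab hr hsep hha
    hhb hvval hvconst hvjump hAr hk₁α hk₂β hk
  have hvint : IntervalIntegrable v volume a b :=
    intervalIntegrable_of_const_off_finite hab.le (C := max |α| |β|) (fun x hx => by
      rcases hvval x hx with h | h <;> simp [h]) hvconst
  have hγ₀0 : 0 ≤ γ₀ := by
    rw [hγ₀]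
    exact intervalIntegral.integral_nonneg hαβ.le fun s hs =>
      mul_nonneg (Real.sqrt_nonneg _) (hB.posD s (hsub hs)).le
  have hexp := tendsto_exp_neg_div_nhdsGT_zero hA
  have hsqrt : Tendsto (fun ε => √ε) (nhdsWithin 0 (Ioi 0)) (nhds 0) := by
    simpa using (Real.continuous_sqrt.tendsto 0).mono_left nhdsWithin_le_nhds
  have key : ∀ m > (0 : ℝ), ∃ C > (0 : ℝ), ∀ᶠ ε in nhdsWithin (0 : ℝ) (Ioi 0),
      ∀ t ∈ Icc (0 : ℝ) (m * Real.exp (A / ε)), ∫ x in a..b, |u ε t x - u ε 0 x| ≤ C * √ε := by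
    intro m hm
    have hba : 0 < b - a := sub_pos.2 hab
    refine ⟨m * (b - a) / 2 + (2 * (N * γ₀) + C₀) / (2 * d), by positivity, ?_⟩
    set C := m * (b - a) / 2 + (2 * (N * γ₀) + C₀) / (2 * d) with hC
    have hCsqrt : Tendsto (fun ε => C * √ε) (nhdsWithin 0 (Ioi 0)) (nhds 0) := by
      simpa using hsqrt.const_mul C
    have hC₀exp : Tendsto (fun ε => C₀ * Real.exp (-A / ε)) (nhdsWithin 0 (Ioi 0)) (nhds 0) := by
      simpa using hexp.const_mul C₀
    filter_upwards [self_mem_nhdsWithin, Ioo_mem_nhdsGT hεa, hC₀exp.eventually_lt_const hη,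
      hCsqrt.eventually_lt_const (half_pos hδ), hL1.eventually_lt_const (half_pos hδ)]
      with ε hε hεa' hεη hεC hεv
    have hε : 0 < ε := hε
    have hs : 0 < √ε := Real.sqrt_pos.2 hε
    set E := Real.exp (-A / ε) with hEdef
    have hE : 0 < E := Real.exp_pos _
    have hEE : Real.exp (A / ε) = E⁻¹ := by rw [hEdef, ← Real.exp_neg, neg_div, neg_neg]
    have hbound : √ε * E * (m * Real.exp (A / ε)) * (b - a) / 2
        + ε * (2 * (N * γ₀) * E + C₀ * E) / d / (2 * (√ε * E)) = C * √ε := by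
      rw [hEE, hC]
      field_simp
      rw [Real.sq_sqrt hε.le]
      ring
    rw [← hbound] at hεC ⊢
    refine (hu ε hε).integral_abs_sub_initial_le hB hε hab.le hd hDd hk hvint (by positivity) hεη
      (fun U U' hU hU' hUk hUv => ?_) (hE0 ε hεa') (fun x hx => ?_) hεv hεC
    · obtain ⟨h1, h2⟩ := hlow ε hε U U' hU hU' hUk hUv
      refine ⟨le_trans (le_of_eq ?_) h1, h2⟩
      ring
    · have h := hval0 ε hε x hx
      exact ⟨hk₁M.le.trans h.1, h.2.trans hk₂M.le⟩
  refine ⟨fun m hm => ?_, fun m hm => ?_⟩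
  · obtain ⟨C, hC, hev⟩ := key m hm
    have hlim : Tendsto (fun ε => C * √ε + ∫ x in a..b, |u ε 0 x - v x|)
        (nhdsWithin 0 (Ioi 0)) (nhds 0) := by
      simpa using (hsqrt.const_mul C).add hL1
    refine tendsto_of_tendsto_of_tendsto_of_le_of_le' tendsto_const_nhds hlim
      (Eventually.of_forall fun ε => Real.iSup_nonneg fun t => Real.iSup_nonneg fun _ =>
        intervalIntegral.integral_nonneg hab.le fun _ _ => abs_nonneg _) ?_
    filter_upwards [self_mem_nhdsWithin, hev] with ε hε hεt
    have hcu : ∀ t, Continuous fun x => u ε t x := fun t =>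
      (hreg ε hε).comp (by fun_prop : Continuous fun x : ℝ => (t, x))
    have hi2 : IntervalIntegrable (fun x => |u ε 0 x - v x|) volume a b :=
      (((hcu 0).intervalIntegrable _ _).sub hvint).abs
    have h0 : 0 ≤ ∫ x in a..b, |u ε 0 x - v x| :=
      intervalIntegral.integral_nonneg hab.le fun _ _ => abs_nonneg _
    have hB0 : 0 ≤ C * √ε + ∫ x in a..b, |u ε 0 x - v x| := by positivity
    refine Real.iSup_le (fun t => Real.iSup_le (fun ht => ?_) hB0) hB0
    have hi1 : IntervalIntegrable (fun x => |u ε t x - u ε 0 x|) volume a b :=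
      ((hcu t).sub (hcu 0)).abs.intervalIntegrable _ _
    calc ∫ x in a..b, |u ε t x - v x|
        ≤ ∫ x in a..b, (|u ε t x - u ε 0 x| + |u ε 0 x - v x|) :=
          intervalIntegral.integral_mono_on hab.le
            ((((hcu t).intervalIntegrable _ _).sub hvint).abs) (hi1.add hi2)
            fun x _ => abs_sub_le _ _ _
      _ = (∫ x in a..b, |u ε t x - u ε 0 x|) + ∫ x in a..b, |u ε 0 x - v x| :=
          intervalIntegral.integral_add hi1 hi2
      _ ≤ _ := by gcongr; exact hεt t ht
  · obtain ⟨C, hC, hev⟩ := key m hm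
    obtain ⟨ε₁, hε₁, hsub₁⟩ := mem_nhdsGT_iff_exists_Ioo_subset.1 hev
    exact ⟨C, hC, ε₁, hε₁, fun ε hε => hsub₁ hε⟩
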